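/- arXiv:math/0310259 — 5 statements merged into one kernel-verified Lean document; each statement's English description precedes it below -/
import Mathlib

section
/- Sum formula for multiple zeta values: for all integers n and r with n ≥ 2 and 1 ≤ r ≤ n − 1, the sum S(n,r) of all multiple zeta values of weight n and depth r equals ζ(n); that is, ∑ ζ(k₁,…,k_r) = ζ(n), where the sum ranges over all tuples of integers (k₁,…,k_r) with k₁ ≥ 2, k₂,…,k_r ≥ 1 and k₁ + ⋯ + k_r = n. -/
open scoped BigOperators

/-- The Riemann zeta value `ζ(n) = ∑_{k ≥ 1} 1/k^n` (as a real series). -/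
noncomputable def riemannZetaReal (n : ℕ) : ℝ :=
  ∑' k : ℕ, 1 / ((k : ℝ) + 1) ^ n

/-- The multiple zeta value `ζ(k₁, …, k_r) = ∑_{n₁ > ⋯ > n_r > 0} 1/(n₁^{k₁} ⋯ n_r^{k_r})`,
the sum ranging over strictly decreasing tuples of positive integers. -/
noncomputable def multipleZeta {r : ℕ} (k : Fin r → ℕ) : ℝ :=
  ∑' n : {n : Fin r → ℕ // StrictAnti n ∧ ∀ i, 0 < n i},
    1 / ∏ i, ((n.1 i : ℝ)) ^ (k i)

/-- `S(n, r)`: the sum of all multiple zeta values of weight `n` and depth `r`,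
i.e. the sum of `ζ(k₁, …, k_r)` over all tuples of integers with `k₁ ≥ 2`,
`k₂, …, k_r ≥ 1` and `k₁ + ⋯ + k_r = n`. -/
noncomputable def zetaSum (n r : ℕ) : ℝ :=
  ∑' k : {k : Fin r → ℕ //
      (∀ i, 1 ≤ k i) ∧ (∀ h : 0 < r, 2 ≤ k ⟨0, h⟩) ∧ (∑ i, k i) = n},
    multipleZeta k.1


namespace MZVaux

/-- connector -/
noncomputable def u (x y : ℝ) (m : ℕ) : ℕ → ℝ
  | 0 => 1 / (m + 1 - x)
  | i + 1 => u x y m i * ((i + 1 - x + y) / (m + 2 + i - x))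

variable {x y : ℝ}

lemma u_pos (hx0 : 0 ≤ x) (hx : x < 1) (hy0 : 0 ≤ y) (m i : ℕ) : 0 < u x y m i := by
  have hm : (0:ℝ) ≤ m := m.cast_nonneg
  induction i with
  | zero => simp only [u]; apply div_pos <;> linarith
  | succ i ih =>
    have hi : (0:ℝ) ≤ i := i.cast_nonneg
    simp only [u]
    apply mul_pos ih; apply div_pos <;> linarith

lemma u_succ_m (hx : x < 1) (m i : ℕ) :
    u x y (m+1) i = u x y m i * ((m + 1 - x) / (m + 2 + i - x)) := by
  have hm : (0:ℝ) ≤ m := m.cast_nonneg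
  induction i with
  | zero =>
    have h1 : (m:ℝ) + 1 - x ≠ 0 := by linarith
    have h2 : (m:ℝ) + 2 - x ≠ 0 := by linarith
    have h3 : (m:ℝ) + 1 + 1 - x = m + 2 - x := by ring
    simp only [u]; push_cast; rw [h3, add_zero]; field_simp
  | succ i ih =>
    have hi : (0:ℝ) ≤ i := i.cast_nonneg
    have h1 : (m:ℝ) + 2 + i - x ≠ 0 := by linarith
    have h2 : (m:ℝ) + 2 + (i + 1) - x ≠ 0 := by linarith
    have h3 : (m:ℝ) + 1 + 2 + i - x ≠ 0 := by linarith
    simp only [u, ih]; push_cast; field_simp; ring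

noncomputable def g (x y : ℝ) (m i : ℕ) : ℝ := u x y m i / (m + 2 + i - x)
noncomputable def t (x y : ℝ) (m i : ℕ) : ℝ := u x y m i / (i + 1)

lemma g_tel (hx : x < 1) (m i : ℕ) :
    (m + 1 - y) * g x y m i = u x y m i - u x y m (i+1) := by
  have hm : (0:ℝ) ≤ m := m.cast_nonneg
  have hi : (0:ℝ) ≤ i := i.cast_nonneg
  have h1 : (m:ℝ) + 2 + i - x ≠ 0 := by linarith
  simp only [g, u]; field_simp; ring

lemma t_sub (hx : x < 1) (m i : ℕ) : t x y m i - t x y (m+1) i = g x y m i := by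
  have hm : (0:ℝ) ≤ m := m.cast_nonneg
  have hi : (0:ℝ) ≤ i := i.cast_nonneg
  have h1 : (m:ℝ) + 2 + i - x ≠ 0 := by linarith
  have h2 : (i:ℝ) + 1 ≠ 0 := by linarith
  simp only [t, g, u_succ_m hx]; field_simp; ring

lemma g_nonneg (hx0 : 0 ≤ x) (hx : x < 1) (hy0 : 0 ≤ y) (m i : ℕ) : 0 ≤ g x y m i := by
  have hm : (0:ℝ) ≤ m := m.cast_nonneg
  have hi : (0:ℝ) ≤ i := i.cast_nonneg
  exact div_nonneg (u_pos hx0 hx hy0 m i).le (by linarith)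

lemma t_nonneg (hx0 : 0 ≤ x) (hx : x < 1) (hy0 : 0 ≤ y) (m i : ℕ) : 0 ≤ t x y m i := by
  have hi : (0:ℝ) ≤ i := i.cast_nonneg
  exact div_nonneg (u_pos hx0 hx hy0 m i).le (by linarith)

lemma g_partial (hx : x < 1) (m n : ℕ) :
    (m + 1 - y) * ∑ i ∈ Finset.range n, g x y m i = u x y m 0 - u x y m n := by
  rw [Finset.mul_sum, Finset.sum_congr rfl (fun i _ => g_tel hx m i), Finset.sum_range_sub']

lemma g_summable (hx0 : 0 ≤ x) (hx : x < 1) (hy0 : 0 ≤ y) (hy : y < 1) (m : ℕ) :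
    Summable (g x y m) := by
  have hm : (0:ℝ) ≤ m := m.cast_nonneg
  have h0 : 0 < (m:ℝ) + 1 - y := by linarith
  refine summable_of_sum_range_le (c := u x y m 0 / (m + 1 - y)) (g_nonneg hx0 hx hy0 m) fun n => ?_
  rw [le_div_iff₀ h0, mul_comm, g_partial hx]
  linarith [u_pos hx0 hx hy0 m n]

lemma t_summable (hx0 : 0 ≤ x) (hx : x < 1) (hy0 : 0 ≤ y) (hy : y < 1) (m : ℕ) :
    Summable (t x y m) := by
  have hm : (0:ℝ) ≤ m := m.cast_nonneg
  refine Summable.of_nonneg_of_le (t_nonneg hx0 hx hy0 m) (fun i => ?_)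
    ((g_summable hx0 hx hy0 hy m).mul_left ((m:ℝ) + 2))
  have hi : (0:ℝ) ≤ i := i.cast_nonneg
  have := u_pos hx0 hx hy0 m i
  simp only [t, g]
  rw [← mul_div_assoc, div_le_div_iff₀ (by linarith) (by linarith)]
  nlinarith [mul_nonneg this.le (mul_nonneg hm hi), mul_nonneg this.le hi, mul_nonneg this.le hx0]

lemma u_tendsto (hx0 : 0 ≤ x) (hx : x < 1) (hy0 : 0 ≤ y) (hy : y < 1) (m : ℕ) :
    Filter.Tendsto (u x y m) Filter.atTop (nhds 0) := by
  have hm : (0:ℝ) ≤ m := m.cast_nonneg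
  have hanti : Antitone (u x y m) := antitone_nat_of_succ_le fun i => by
    have := g_tel (y := y) hx m i
    have h2 := mul_nonneg (by linarith : 0 ≤ (m:ℝ) + 1 - y) (g_nonneg hx0 hx hy0 m i)
    linarith
  have hb : BddBelow (Set.range (u x y m)) := ⟨0, by
    rintro _ ⟨i, rfl⟩; exact (u_pos hx0 hx hy0 m i).le⟩
  have hl := tendsto_atTop_ciInf hanti hb
  set L := ⨅ i, u x y m i with hL
  have hL0 : 0 ≤ L := le_ciInf fun i => (u_pos hx0 hx hy0 m i).le
  rcases hL0.eq_or_lt with h | h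
  · rwa [← h] at hl
  exfalso
  have hs : Summable fun i : ℕ => ((i + 1 : ℕ) : ℝ)⁻¹ := by
    refine Summable.of_nonneg_of_le (fun i => by positivity) (fun i => ?_)
      ((t_summable hx0 hx hy0 hy m).mul_left L⁻¹)
    have h1 : L ≤ u x y m i := ciInf_le hb i
    have hi : (0:ℝ) ≤ i := i.cast_nonneg
    simp only [t]; push_cast
    rw [inv_mul_eq_div, div_div, inv_eq_one_div, div_le_div_iff₀ (by linarith) (by positivity)]
    nlinarith
  exact Real.not_summable_natCast_inv ((summable_nat_add_iff 1).1 hs)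

lemma g_tsum (hx0 : 0 ≤ x) (hx : x < 1) (hy0 : 0 ≤ y) (hy : y < 1) (m : ℕ) :
    ∑' i, g x y m i = 1 / ((m + 1 - x) * (m + 1 - y)) := by
  have hm : (0:ℝ) ≤ m := m.cast_nonneg
  have h0 : 0 < (m:ℝ) + 1 - y := by linarith
  have h1 := ((g_summable hx0 hx hy0 hy m).hasSum.tendsto_sum_nat).const_mul ((m:ℝ) + 1 - y)
  simp only [g_partial hx] at h1
  have h2 := (tendsto_const_nhds (x := u x y m 0)).sub (u_tendsto hx0 hx hy0 hy m)
  have h3 := tendsto_nhds_unique h1 h2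
  have h4 : (m:ℝ) + 1 - x ≠ 0 := by linarith
  rw [sub_zero] at h3
  simp only [u] at h3
  rw [eq_div_iff (by positivity), mul_comm, mul_assoc, h3]
  field_simp

lemma t_le (hx0 : 0 ≤ x) (hx : x < 1) (hy0 : 0 ≤ y) (m i : ℕ) :
    t x y m i ≤ t x y 0 i / (m + 1 - x) := by
  induction m with
  | zero =>
    rw [le_div_iff₀ (by push_cast; linarith)]
    push_cast
    nlinarith [t_nonneg hx0 hx hy0 0 i]
  | succ m ih =>
    have hm : (0:ℝ) ≤ m := m.cast_nonneg
    have hi : (0:ℝ) ≤ i := i.cast_nonneg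
    have h : t x y (m+1) i = t x y m i * ((m + 1 - x) / (m + 2 + i - x)) := by
      simp only [t, u_succ_m hx]; ring
    have h0 := t_nonneg hx0 hx hy0 0 i
    have h4 : 0 < (m:ℝ) + 1 - x := by linarith
    have h5 : 0 < (m:ℝ) + 2 + i - x := by linarith
    have h6 : 0 < (m:ℝ) + 1 + 1 - x := by linarith
    rw [h]
    calc _ ≤ t x y 0 i / (m + 1 - x) * ((m + 1 - x) / (m + 2 + i - x)) := by gcongr
      _ = t x y 0 i / (m + 2 + i - x) := by field_simp
      _ ≤ _ := by push_cast; exact div_le_div_of_nonneg_left h0 h6 (by linarith)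

lemma key (hx0 : 0 ≤ x) (hx : x < 1) (hy0 : 0 ≤ y) (hy : y < 1) :
    HasSum (fun m : ℕ => 1 / (((m:ℝ) + 1 - x) * (m + 1 - y))) (∑' i, t x y 0 i) := by
  rw [hasSum_iff_tendsto_nat_of_nonneg]
  · have hp : ∀ M : ℕ, ∑ m ∈ Finset.range M, 1 / (((m:ℝ) + 1 - x) * (m + 1 - y))
        = ∑' i, t x y 0 i - ∑' i, t x y M i := fun M => by
      rw [← Finset.sum_range_sub' (fun m => ∑' i, t x y m i)]
      refine Finset.sum_congr rfl fun m _ => ?_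
      rw [← g_tsum hx0 hx hy0 hy, ← (t_summable hx0 hx hy0 hy m).tsum_sub
        (t_summable hx0 hx hy0 hy (m+1))]
      exact tsum_congr fun i => (t_sub hx m i).symm
    simp only [hp]
    have : Filter.Tendsto (fun M : ℕ => ∑' i, t x y M i) Filter.atTop (nhds 0) := by
      refine squeeze_zero (fun M => tsum_nonneg (t_nonneg hx0 hx hy0 M))
        (g := fun M : ℕ => (∑' i, t x y 0 i) / (M + 1 - x)) (fun M => ?_) ?_
      · rw [← tsum_div_const]
        exact (t_summable hx0 hx hy0 hy M).tsum_le_tsum (t_le hx0 hx hy0 M)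
          ((t_summable hx0 hx hy0 hy 0).div_const _)
      · refine Filter.Tendsto.const_div_atTop ?_ _
        have : (fun M : ℕ => (M:ℝ) + 1 - x) = fun M : ℕ => (M:ℝ) + (1 - x) := by
          ext; ring
        rw [this]
        exact Filter.tendsto_atTop_add_const_right _ _ tendsto_natCast_atTop_atTop
    simpa using (tendsto_const_nhds (x := ∑' i, t x y 0 i)).sub this
  · intro m
    have hm : (0:ℝ) ≤ m := m.cast_nonneg
    exact div_nonneg zero_le_one (mul_nonneg (by linarith) (by linarith))

/-- uniqueness of coefficients -/
lemma coeff_real (n : ℕ) : ∀ c : ℕ → ℝ, (Summable fun k => |c k| * (1/2) ^ k) →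
    (∀ z : ℝ, 0 < z → z ≤ 1/2 → ∑' k, c k * z ^ k = 0) → c n = 0 := by
  have base : ∀ c : ℕ → ℝ, (Summable fun k => |c k| * (1/2) ^ k) →
    (∀ z : ℝ, 0 < z → z ≤ 1/2 → ∑' k, c k * z ^ k = 0) →
      (∀ z : ℝ, 0 < z → z ≤ 1/2 → c 0 = - (z * ∑' k, c (k+1) * z ^ k)) ∧ c 0 = 0 ∧
      (Summable fun k => |c (k+1)| * (1/2) ^ k) := by
    intro c hs hz
    have hs1 : Summable fun k => |c (k+1)| * (1/2) ^ k := by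
      have := ((summable_nat_add_iff 1).2 hs).mul_left 2
      refine this.congr fun k => ?_
      rw [pow_succ]; ring
    have e1 : ∀ z : ℝ, 0 < z → z ≤ 1/2 → c 0 = - (z * ∑' k, c (k+1) * z ^ k) := by
      intro z h0 h1
      have hsz : Summable fun k => c k * z ^ k := by
        refine Summable.of_norm_bounded hs fun k => ?_
        rw [Real.norm_eq_abs, abs_mul, abs_pow, abs_of_pos h0]; gcongr
      have := hz z h0 h1
      rw [hsz.tsum_eq_zero_add] at this
      rw [← tsum_mul_left]
      have h3 : ∀ k, c (k+1) * z ^ (k+1) = z * (c (k+1) * z ^ k) := fun k => by ring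
      simp only [h3] at this
      simp at this; linarith
    refine ⟨e1, ?_, hs1⟩
    set K := ∑' k, |c (k+1)| * (1/2) ^ k
    have hK : ∀ z : ℝ, 0 < z → z ≤ 1/2 → |c 0| ≤ z * K := by
      intro z h0 h1
      rw [e1 z h0 h1, abs_neg, abs_mul, abs_of_pos h0]
      gcongr
      rw [← Real.norm_eq_abs]
      refine tsum_of_norm_bounded hs1.hasSum fun k => ?_
      rw [Real.norm_eq_abs, abs_mul, abs_pow, abs_of_pos h0]; gcongr
    by_contra hc
    have hc' : 0 < |c 0| := abs_pos.2 hc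
    have hK0 : 0 ≤ K := tsum_nonneg fun k => by positivity
    have hz1 : 0 < min (1/2) (|c 0| / (2 * (K + 1))) := by positivity
    have := hK _ hz1 (min_le_left _ _)
    have h2 : min (1/2) (|c 0| / (2 * (K + 1))) * K ≤ |c 0| / (2 * (K + 1)) * (K + 1) := by
      gcongr
      · exact min_le_right _ _
      · linarith
    have h3 : |c 0| / (2 * (K + 1)) * (K + 1) = |c 0| / 2 := by field_simp
    linarith
  induction n with
  | zero => intro c hs hz; exact (base c hs hz).2.1
  | succ n ih =>
    intro c hs hz
    obtain ⟨b1, b2, b3⟩ := base c hs hz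
    refine ih (fun k => c (k+1)) b3 fun z h0 h1 => ?_
    have := b1 z h0 h1
    rw [b2, eq_comm, neg_eq_zero, mul_eq_zero] at this
    exact this.resolve_left h0.ne'

open scoped ENNReal

lemma coeff_ennreal (A B : ℕ → ℝ≥0∞)
    (h : ∀ z : ℝ, 0 < z → z ≤ 1/2 → ∑' k, A k * ENNReal.ofReal z ^ k = ∑' k, B k * ENNReal.ofReal z ^ k)
    (hB : ∑' k, B k * ENNReal.ofReal (1/2) ^ k ≠ ∞) : A = B := by
  have hA : ∑' k, A k * ENNReal.ofReal (1/2) ^ k ≠ ∞ := by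
    rw [h _ (by norm_num) le_rfl]; exact hB
  have fin : ∀ A : ℕ → ℝ≥0∞, ∑' k, A k * ENNReal.ofReal (1/2) ^ k ≠ ∞ →
      (∀ k, A k ≠ ∞) ∧ (Summable fun k => (A k).toReal * (1/2) ^ k) ∧
      ∀ z : ℝ, 0 < z → z ≤ 1/2 → (Summable fun k => (A k).toReal * z ^ k) ∧ 
        (∑' k, A k * ENNReal.ofReal z ^ k).toReal = ∑' k, (A k).toReal * z ^ k := by
    intro A hA
    have h1 : ∀ k, A k ≠ ∞ := fun k hk => by
      have := ENNReal.ne_top_of_tsum_ne_top hA k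
      apply this
      rw [hk, ENNReal.top_mul]
      exact pow_ne_zero _ (by simp)
    have h2 : (Summable fun k => (A k).toReal * (1/2) ^ k) := by
      refine (ENNReal.summable_toReal hA).congr fun k => ?_
      rw [ENNReal.toReal_mul, ENNReal.toReal_pow, ENNReal.toReal_ofReal (by norm_num)]
    refine ⟨h1, h2, fun z h0 hz => ⟨?_, ?_⟩⟩
    · refine Summable.of_nonneg_of_le (fun k => by positivity) (fun k => ?_) h2
      gcongr
    · rw [ENNReal.tsum_toReal_eq]
      · refine tsum_congr fun k => ?_
        rw [ENNReal.toReal_mul, ENNReal.toReal_pow, ENNReal.toReal_ofReal h0.le]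
      · intro k
        exact ENNReal.mul_ne_top (h1 k) (ENNReal.pow_ne_top ENNReal.ofReal_ne_top)
  obtain ⟨a1, a2, a3⟩ := fin A hA
  obtain ⟨b1, b2, b3⟩ := fin B hB
  funext n
  rw [← ENNReal.toReal_eq_toReal_iff' (a1 n) (b1 n), ← sub_eq_zero]
  refine coeff_real n (fun k => (A k).toReal - (B k).toReal) ?_ fun z h0 h1 => ?_
  · refine Summable.of_nonneg_of_le (fun k => by positivity) (fun k => ?_) (a2.add b2)
    rw [← add_mul]
    gcongr
    refine (abs_sub _ _).trans ?_
    rw [abs_of_nonneg ENNReal.toReal_nonneg, abs_of_nonneg ENNReal.toReal_nonneg]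
  · simp only [sub_mul]
    rw [(a3 z h0 h1).1.tsum_sub (b3 z h0 h1).1, ← (a3 z h0 h1).2, ← (b3 z h0 h1).2, h z h0 h1, sub_self]

end MZVaux
open scoped ENNReal

namespace MZVaux

noncomputable def v (j : ℕ) : ℝ≥0∞ := (j : ℝ≥0∞)⁻¹

noncomputable def F (X : ℝ≥0∞) (j : ℕ) : ℝ≥0∞ := ∑' a : ℕ, X ^ a * v j ^ (a + 1)

abbrev K (n r : ℕ) := {k : Fin r → ℕ //
      (∀ i, 1 ≤ k i) ∧ (∀ h : 0 < r, 2 ≤ k ⟨0, h⟩) ∧ (∑ i, k i) = n}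

abbrev D (r : ℕ) := {n : Fin r → ℕ // StrictAnti n ∧ ∀ i, 0 < n i}

noncomputable def S' (n r : ℕ) : ℝ≥0∞ := ∑' k : K n r, ∑' d : D r, ∏ i, v (d.1 i) ^ (k.1 i)

noncomputable def Z' (n : ℕ) : ℝ≥0∞ := ∑' m : ℕ, v (m + 1) ^ n

lemma tsum_cons {b : ℕ} (f : (Fin (b+1) → ℕ) → ℝ≥0∞) :
    ∑' e, f e = ∑' M : ℕ, ∑' t : Fin b → ℕ, f (Fin.cons M t) := by
  rw [← (Fin.consEquiv (fun _ : Fin (b+1) => ℕ)).tsum_eq f, ENNReal.tsum_prod']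
  rfl

lemma prod_tsum : ∀ (b : ℕ) (f : Fin b → ℕ → ℝ≥0∞),
    ∑' e : Fin b → ℕ, ∏ i, f i (e i) = ∏ i, ∑' a, f i a
  | 0, f => by simp
  | b + 1, f => by
    rw [tsum_cons, Fin.prod_univ_succ, ← prod_tsum b]
    simp only [Fin.prod_univ_succ, Fin.cons_zero, Fin.cons_succ, ENNReal.tsum_mul_left,
      ENNReal.tsum_mul_right]

open Classical in
noncomputable def G (f : ℕ → ℝ≥0∞) (b N : ℕ) : ℝ≥0∞ :=
  ∑' t : Fin b → ℕ, if (StrictAnti t ∧ ∀ i, 0 < t i ∧ t i < N) then ∏ i, f (t i) else 0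

lemma G_zero (f : ℕ → ℝ≥0∞) (N : ℕ) : G f 0 N = 1 := by
  have : ∀ t : Fin 0 → ℕ, StrictAnti t := fun t i => i.elim0
  simp [G, this]

lemma anti_cons {b : ℕ} (M : ℕ) (t : Fin b → ℕ) :
    StrictAnti (Fin.cons M t : Fin (b+1) → ℕ) ↔ StrictAnti t ∧ ∀ i, t i < M := by
  constructor
  · intro h
    refine ⟨fun i j hij => ?_, fun i => ?_⟩
    · simpa using h (Fin.succ_lt_succ_iff.2 hij)
    · simpa using h (Fin.succ_pos i)
  · rintro ⟨h1, h2⟩ i j hij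
    induction j using Fin.cases with
    | zero => exact absurd hij (Fin.not_lt_zero i)
    | succ j =>
      induction i using Fin.cases with
      | zero => simpa using h2 j
      | succ i => simpa using h1 (Fin.succ_lt_succ_iff.1 hij)

open Classical in
lemma G_succ (f : ℕ → ℝ≥0∞) (b N : ℕ) :
    G f (b+1) N = ∑' M : ℕ, if 0 < M ∧ M < N then f M * G f b M else 0 := by
  rw [G, tsum_cons]
  refine tsum_congr fun M => ?_
  split_ifs with h
  · rw [G, ← ENNReal.tsum_mul_left]
    refine tsum_congr fun t => ?_
    rw [mul_ite, mul_zero]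
    have : (StrictAnti (Fin.cons M t : Fin (b+1) → ℕ) ∧ ∀ i, 0 < (Fin.cons M t : Fin (b+1) → ℕ) i ∧
        (Fin.cons M t : Fin (b+1) → ℕ) i < N) ↔ (StrictAnti t ∧ ∀ i, 0 < t i ∧ t i < M) := by
      rw [anti_cons, Fin.forall_fin_succ]
      simp only [Fin.cons_zero, Fin.cons_succ]
      constructor
      · rintro ⟨⟨a, b⟩, c, d⟩
        exact ⟨a, fun i => ⟨(d i).1, b i⟩⟩
      · rintro ⟨a, b⟩
        exact ⟨⟨a, fun i => (b i).2⟩, h, fun i => ⟨(b i).1, (b i).2.trans h.2⟩⟩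
    simp only [this, Fin.prod_univ_succ, Fin.cons_zero, Fin.cons_succ]
  · rw [ENNReal.tsum_eq_zero]
    intro t
    rw [if_neg]
    rintro ⟨-, h2⟩
    exact h (by simpa using h2 0)

lemma G_succ' (f : ℕ → ℝ≥0∞) (b N : ℕ) :
    G f (b+1) N = ∑ M ∈ Finset.Ico 1 N, f M * G f b M := by
  rw [G_succ, tsum_eq_sum (s := Finset.Ico 1 N)]
  · refine Finset.sum_congr rfl fun M hM => ?_
    rw [Finset.mem_Ico] at hM
    rw [if_pos ⟨hM.1, hM.2⟩]
  · intro M hM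
    rw [if_neg]
    rintro ⟨h1, h2⟩
    exact hM (Finset.mem_Ico.2 ⟨h1, h2⟩)

lemma G_gen (f : ℕ → ℝ≥0∞) (Y : ℝ≥0∞) (N : ℕ) :
    ∑' b, G f b (N+1) * Y ^ b = ∏ j ∈ Finset.range N, (1 + Y * f (j+1)) := by
  induction N with
  | zero =>
    rw [tsum_eq_single 0]
    · simp [G_zero]
    · intro b hb
      obtain ⟨b, rfl⟩ := Nat.exists_eq_succ_of_ne_zero hb
      simp [G_succ']
  | succ N ih =>
    rw [Finset.prod_range_succ, ← ih, mul_add, mul_one]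
    rw [tsum_eq_zero_add' ENNReal.summable]
    conv_rhs => rw [tsum_eq_zero_add' ENNReal.summable]
    have h : ∀ b, G f (b+1) (N+1+1) * Y ^ (b+1) =
        G f (b+1) (N+1) * Y ^ (b+1) + (G f b (N+1) * Y ^ b) * (Y * f (N+1)) := fun b => by
      rw [G_succ' f b (N+1+1), Finset.sum_Ico_succ_top (by omega), ← G_succ']; ring
    simp only [h, ENNReal.tsum_add, ENNReal.tsum_mul_right, G_zero]
    rw [add_assoc]
    conv_lhs => rw [tsum_eq_zero_add' (f := fun b => G f b (N+1) * Y ^ b) ENNReal.summable]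
    simp only [G_zero]

lemma D_sum (f : ℕ → ℝ≥0∞) (b : ℕ) :
    ∑' d : D (b+1), v (d.1 0) * ∏ i, f (d.1 i) = ∑' N : ℕ, v (N+1) * f (N+1) * G f b (N+1) := by
  classical
  have h0 : ∑' d : D (b+1), v (d.1 0) * ∏ i, f (d.1 i)
      = ∑' d : Fin (b+1) → ℕ, if (StrictAnti d ∧ ∀ i, 0 < d i) then v (d 0) * ∏ i, f (d i) else 0 := by
    have := tsum_subtype {d : Fin (b+1) → ℕ | StrictAnti d ∧ ∀ i, 0 < d i}
      (fun d => v (d 0) * ∏ i, f (d i))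
    refine Eq.trans this (tsum_congr fun d => ?_)
    rw [Set.indicator_apply]; rfl
  have h1 : ∀ M : ℕ, (∑' t : Fin b → ℕ, if (StrictAnti (Fin.cons M t : Fin (b+1) → ℕ) ∧
      ∀ i, 0 < (Fin.cons M t : Fin (b+1) → ℕ) i) then v ((Fin.cons M t : Fin (b+1) → ℕ) 0) *
      ∏ i, f ((Fin.cons M t : Fin (b+1) → ℕ) i) else 0) =
      if 0 < M then v M * f M * G f b M else 0 := fun M => by
    split_ifs with h
    · rw [G, ← ENNReal.tsum_mul_left]
      refine tsum_congr fun t => ?_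
      rw [mul_ite, mul_zero]
      have : (StrictAnti (Fin.cons M t : Fin (b+1) → ℕ) ∧ ∀ i, 0 < (Fin.cons M t : Fin (b+1) → ℕ) i)
          ↔ (StrictAnti t ∧ ∀ i, 0 < t i ∧ t i < M) := by
        rw [anti_cons, Fin.forall_fin_succ]
        simp only [Fin.cons_zero, Fin.cons_succ]
        constructor
        · rintro ⟨⟨a, b⟩, c, d⟩
          exact ⟨a, fun i => ⟨d i, b i⟩⟩
        · rintro ⟨a, b⟩
          exact ⟨⟨a, fun i => (b i).2⟩, h, fun i => (b i).1⟩
      simp only [this, Fin.prod_univ_succ, Fin.cons_zero, Fin.cons_succ, mul_assoc]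
    · rw [ENNReal.tsum_eq_zero]
      intro t
      rw [if_neg]
      rintro ⟨-, h2⟩
      exact h (by simpa using h2 0)
  rw [h0, tsum_cons]
  simp only [h1]
  rw [tsum_eq_zero_add' ENNReal.summable]
  simp

def kEquiv (a b : ℕ) : {e : Fin (b+1) → ℕ // ∑ i, e i = a} ≃ K (a + b + 2) (b + 1) where
  toFun e := ⟨fun i => e.1 i + 1 + if i = 0 then 1 else 0, fun i => by dsimp only; omega, fun h => by
    have : (⟨0, h⟩ : Fin (b+1)) = 0 := rfl
    rw [this]; dsimp only; rw [if_pos rfl]; omega, by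
    have := e.2
    simp [Finset.sum_add_distrib, this]; omega⟩
  invFun k := ⟨fun i => k.1 i - (1 + if i = 0 then 1 else 0), by
    have h1 := k.2.2.2
    have h2 : ∑ i, k.1 i = ∑ i, ((k.1 i - (1 + if i = 0 then 1 else 0)) + 1 + if i = 0 then 1 else 0) := by
      refine Finset.sum_congr rfl fun i _ => ?_
      have h3 := k.2.1 i
      have h4 := k.2.2.1 (Nat.succ_pos b)
      split_ifs with h
      · subst h
        have : (⟨0, Nat.succ_pos b⟩ : Fin (b+1)) = 0 := rfl
        rw [this] at h4; omega
      · omega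
    rw [h1, Finset.sum_add_distrib, Finset.sum_add_distrib] at h2
    simp at h2
    simp; omega⟩
  left_inv e := by
    ext i; simp; omega
  right_inv k := by
    ext i
    have h3 := k.2.1 i
    have h4 := k.2.2.1 (Nat.succ_pos b)
    simp only
    split_ifs with h
    · subst h
      have : (⟨0, Nat.succ_pos b⟩ : Fin (b+1)) = 0 := rfl
      rw [this] at h4; omega
    · omega

lemma A_eq (X : ℝ≥0∞) (b : ℕ) :
    ∑' a, S' (a + b + 2) (b + 1) * X ^ a
      = ∑' N : ℕ, v (N+1) * F X (N+1) * G (F X) b (N+1) := by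
  have h1 : ∀ a, S' (a + b + 2) (b + 1) * X ^ a = ∑' e : {e : Fin (b+1) → ℕ // ∑ i, e i = a},
      ∑' d : D (b+1), v (d.1 0) * ∏ i, (X ^ (e.1 i) * v (d.1 i) ^ (e.1 i + 1)) := fun a => by
    rw [S', ← (kEquiv a b).tsum_eq, ← ENNReal.tsum_mul_right]
    refine tsum_congr fun e => ?_
    rw [← ENNReal.tsum_mul_right]
    refine tsum_congr fun d => ?_
    rw [Finset.prod_mul_distrib, Finset.prod_pow_eq_pow_sum, e.2]
    simp only [kEquiv, Equiv.coe_fn_mk]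
    simp only [pow_add _ (_ + 1) (ite _ _ _), Finset.prod_mul_distrib]
    have : ∏ i, v (d.1 i) ^ (if i = 0 then 1 else 0) = v (d.1 0) := by
      rw [Finset.prod_eq_single 0] <;> simp +contextual
    rw [this]; ring
  simp only [h1]
  rw [← D_sum, ← ENNReal.tsum_sigma' (fun p : Σ a, {e : Fin (b+1) → ℕ // ∑ i, e i = a} =>
    ∑' d : D (b+1), v (d.1 0) * ∏ i, (X ^ (p.2.1 i) * v (d.1 i) ^ (p.2.1 i + 1)))]
  have := (Equiv.sigmaFiberEquiv (fun e : Fin (b+1) → ℕ => ∑ i, e i)).tsum_eq (fun e =>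
    ∑' d : D (b+1), v (d.1 0) * ∏ i, (X ^ (e i) * v (d.1 i) ^ (e i + 1)))
  refine Eq.trans this ?_
  rw [ENNReal.tsum_comm]
  refine tsum_congr fun d => ?_
  rw [ENNReal.tsum_mul_left]
  congr 1
  exact prod_tsum (b+1) (fun i a => X ^ a * v (d.1 i) ^ (a + 1))

lemma B_eq (X Y : ℝ≥0∞) :
    ∑' b, (∑' a, Z' (a + b + 2) * X ^ a) * Y ^ b = ∑' m : ℕ, F X (m+1) * F Y (m+1) := by
  simp only [Z', F, ← ENNReal.tsum_mul_right]
  have : ∀ b, ∑' (a : ℕ) (m : ℕ), v (m+1) ^ (a + b + 2) * X ^ a * Y ^ b =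
    ∑' (m : ℕ) (a : ℕ), v (m+1) ^ (a + b + 2) * X ^ a * Y ^ b := fun b => ENNReal.tsum_comm
  simp only [this]
  rw [ENNReal.tsum_comm]
  refine tsum_congr fun m => ?_
  rw [ENNReal.tsum_comm]
  refine tsum_congr fun a => ?_
  rw [← ENNReal.tsum_mul_left]
  refine tsum_congr fun b => ?_
  ring

lemma F_eq {x : ℝ} (hx0 : 0 ≤ x) (hx : x < 1) (j : ℕ) :
    F (ENNReal.ofReal x) (j+1) = ENNReal.ofReal (1 / (j + 1 - x)) := by
  have hj : (0:ℝ) ≤ j := j.cast_nonneg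
  have hv : v (j+1) = ENNReal.ofReal (1 / (j+1)) := by
    rw [v, one_div, ENNReal.ofReal_inv_of_pos (by linarith)]
    congr 1
    rw [← Nat.cast_succ, ENNReal.ofReal_natCast]
  have hr : x / (j+1) < 1 := by rw [div_lt_one (by linarith)]; linarith
  have hr0 : 0 ≤ x / (j+1) := by positivity
  have hs : ∀ a : ℕ, ENNReal.ofReal x ^ a * v (j+1) ^ (a+1) =
      ENNReal.ofReal ((1 / (j+1)) * (x / (j+1)) ^ a) := fun a => by
    rw [hv, ← ENNReal.ofReal_pow hx0, ← ENNReal.ofReal_pow (by positivity),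
      ← ENNReal.ofReal_mul (by positivity)]
    congr 1
    rw [div_pow, div_pow, pow_succ]; field_simp; ring
  rw [F]
  simp only [hs]
  rw [← ENNReal.ofReal_tsum_of_nonneg (fun a => by positivity)
    ((summable_geometric_of_lt_one hr0 hr).mul_left _), tsum_mul_left,
    tsum_geometric_of_lt_one hr0 hr]
  congr 1
  have : (j:ℝ) + 1 - x ≠ 0 := by linarith
  have h2 : 1 - x / ((j:ℝ)+1) ≠ 0 := by linarith
  field_simp

end MZVaux

namespace MZVaux
open scoped ENNReal

lemma u_prod {x y : ℝ} (hx : x < 1) (i : ℕ) :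
    u x y 0 i = 1 / (i + 1 - x) * ∏ j ∈ Finset.range i, (1 + y * (1 / (j + 1 - x))) := by
  induction i with
  | zero => simp [u]
  | succ i ih =>
    have hi : (0:ℝ) ≤ i := i.cast_nonneg
    have h1 : (i:ℝ) + 1 - x ≠ 0 := by linarith
    have h2 : (i:ℝ) + 1 + 1 - x ≠ 0 := by linarith
    have h3 : ((0:ℕ):ℝ) + 2 + i - x = i + 1 + 1 - x := by push_cast; ring
    rw [Finset.prod_range_succ, u, ih, h3]
    push_cast
    field_simp

lemma main {x y : ℝ} (hx0 : 0 ≤ x) (hx : x < 1) (hy0 : 0 ≤ y) (hy : y < 1) :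
    ∑' b, (∑' a, S' (a + b + 2) (b + 1) * ENNReal.ofReal x ^ a) * ENNReal.ofReal y ^ b
      = ∑' b, (∑' a, Z' (a + b + 2) * ENNReal.ofReal x ^ a) * ENNReal.ofReal y ^ b ∧
    ∑' b, (∑' a, Z' (a + b + 2) * ENNReal.ofReal x ^ a) * ENNReal.ofReal y ^ b ≠ ∞ := by
  have hB : ∑' b, (∑' a, Z' (a + b + 2) * ENNReal.ofReal x ^ a) * ENNReal.ofReal y ^ b
      = ENNReal.ofReal (∑' i, t x y 0 i) := by
    have hk := key hx0 hx hy0 hy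
    rw [B_eq, ← hk.tsum_eq, ENNReal.ofReal_tsum_of_nonneg _ hk.summable]
    · refine tsum_congr fun m => ?_
      have hm : (0:ℝ) ≤ m := m.cast_nonneg
      rw [F_eq hx0 hx, F_eq hy0 hy, ← ENNReal.ofReal_mul (div_nonneg zero_le_one (by linarith))]
      congr 1
      rw [div_mul_div_comm, one_mul]
    · intro m
      have hm : (0:ℝ) ≤ m := m.cast_nonneg
      exact div_nonneg zero_le_one (mul_nonneg (by linarith) (by linarith))
  rw [hB]
  refine ⟨?_, ENNReal.ofReal_ne_top⟩
  simp only [A_eq, ← ENNReal.tsum_mul_right]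
  rw [ENNReal.tsum_comm, ENNReal.ofReal_tsum_of_nonneg (t_nonneg hx0 hx hy0 0)
    (t_summable hx0 hx hy0 hy 0)]
  refine tsum_congr fun N => ?_
  simp only [mul_assoc, ENNReal.tsum_mul_left]
  rw [G_gen]
  have hN : (0:ℝ) ≤ N := N.cast_nonneg
  have hv : v (N+1) = ENNReal.ofReal (1 / (N+1)) := by
    rw [v, one_div, ENNReal.ofReal_inv_of_pos (by linarith)]
    congr 1
    rw [← Nat.cast_succ, ENNReal.ofReal_natCast]
  have hp : ∀ j : ℕ, 0 ≤ 1 / ((j:ℝ) + 1 - x) := fun j => by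
    have hj : (0:ℝ) ≤ j := j.cast_nonneg
    exact div_nonneg zero_le_one (by linarith)
  have hq : ∀ j : ℕ, 1 + ENNReal.ofReal y * F (ENNReal.ofReal x) (j+1) =
      ENNReal.ofReal (1 + y * (1 / (j + 1 - x))) := fun j => by
    rw [F_eq hx0 hx, ← ENNReal.ofReal_mul hy0, ENNReal.ofReal_add zero_le_one
      (mul_nonneg hy0 (hp j)), ENNReal.ofReal_one]
  simp only [hq]
  rw [← ENNReal.ofReal_prod_of_nonneg (fun j _ => add_nonneg zero_le_one (mul_nonneg hy0 (hp j))),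
    F_eq hx0 hx, ← ENNReal.ofReal_mul (hp N), ← u_prod hx, hv,
    ← ENNReal.ofReal_mul (by positivity)]
  congr 1
  rw [t]; ring

lemma S_eq (a b : ℕ) : S' (a + b + 2) (b + 1) = Z' (a + b + 2) := by
  have h1 : ∀ x : ℝ, 0 < x → x ≤ 1/2 → ∀ b, 
      ∑' a, S' (a + b + 2) (b + 1) * ENNReal.ofReal x ^ a
        = ∑' a, Z' (a + b + 2) * ENNReal.ofReal x ^ a := by
    intro x h0 hx b
    refine congrFun (coeff_ennreal (fun b => ∑' a, S' (a + b + 2) (b + 1) * ENNReal.ofReal x ^ a)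
      (fun b => ∑' a, Z' (a + b + 2) * ENNReal.ofReal x ^ a) (fun y hy0 hy => ?_) ?_) b
    · exact (main h0.le (by linarith) hy0.le (by linarith)).1
    · exact (main h0.le (by linarith) (by norm_num) (by norm_num)).2
  refine congrFun (coeff_ennreal (fun a => S' (a + b + 2) (b + 1)) (fun a => Z' (a + b + 2))
    (fun x h0 hx => h1 x h0 hx b) fun h => ?_) a
  have := ENNReal.ne_top_of_tsum_ne_top (main (x := 1/2) (y := 1/2) (by norm_num) (by norm_num)
    (by norm_num) (by norm_num)).2 b
  apply this
  rw [h, ENNReal.top_mul]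
  exact pow_ne_zero _ (by simp)

lemma v_toReal (j : ℕ) : (v j).toReal = (j:ℝ)⁻¹ := by simp [v]

lemma v_ne_top {j : ℕ} (h : 0 < j) : v j ≠ ∞ := by simp [v]; omega

lemma Z_toReal (n : ℕ) : (Z' n).toReal = riemannZetaReal n := by
  rw [Z', riemannZetaReal, ENNReal.tsum_toReal_eq]
  · refine tsum_congr fun m => ?_
    rw [ENNReal.toReal_pow, v_toReal]; simp
  · intro m
    exact ENNReal.pow_ne_top (v_ne_top (Nat.succ_pos m))

lemma Z_ne_top {n : ℕ} (hn : 2 ≤ n) : Z' n ≠ ∞ := by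
  have h : ∀ m : ℕ, v (m+1) ^ n = ENNReal.ofReal (1 / ((m + 1 : ℕ) : ℝ) ^ n) := fun m => by
    rw [← ENNReal.ofReal_toReal (ENNReal.pow_ne_top (n := n) (v_ne_top (Nat.succ_pos m))),
      ENNReal.toReal_pow, v_toReal]
    congr 1
    simp
  rw [Z']
  simp only [h]
  have hs : Summable fun m : ℕ => 1 / ((m + 1 : ℕ) : ℝ) ^ n :=
    (summable_nat_add_iff (f := fun m : ℕ => 1 / (m : ℝ) ^ n) 1).2
      (Real.summable_one_div_nat_pow.2 (by omega))
  exact hs.tsum_ofReal_ne_top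

lemma S_toReal {n r : ℕ} (h : S' n r ≠ ∞) : (S' n r).toReal = zetaSum n r := by
  rw [S'] at h ⊢
  rw [zetaSum, ENNReal.tsum_toReal_eq (ENNReal.ne_top_of_tsum_ne_top h)]
  refine tsum_congr fun k => ?_
  rw [multipleZeta, ENNReal.tsum_toReal_eq]
  · refine tsum_congr fun d => ?_
    rw [ENNReal.toReal_prod]
    simp [v_toReal]
  · intro d
    exact ENNReal.prod_ne_top fun i _ => ENNReal.pow_ne_top (v_ne_top (d.2.2 i))

end MZVaux

/-- Sum formula for multiple zeta values: for `n ≥ 2` and `1 ≤ r ≤ n - 1`,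
`S(n, r) = ζ(n)`. -/
theorem sum_formula_MZV (n r : ℕ) (hn : 2 ≤ n) (hr : 1 ≤ r) (hrn : r ≤ n - 1) :
    zetaSum n r = riemannZetaReal n := by
  obtain ⟨b, rfl⟩ : ∃ b, r = b + 1 := ⟨r - 1, by omega⟩
  obtain ⟨a, rfl⟩ : ∃ a, n = a + b + 2 := ⟨n - b - 2, by omega⟩
  have h := MZVaux.S_eq a b
  have h2 := MZVaux.Z_ne_top hn
  rw [← MZVaux.S_toReal (h ▸ h2), h, MZVaux.Z_toReal]
end

section
/- Landen's formula for the dilogarithm: for every real z with 0 < z < 1/2, Li₂(z) = −Li₂(z/(z−1)) − Li_{1,1}(z/(z−1)), where Li_{1,1}(w) = ∑_{n₁>n₂>0} w^{n₁}/(n₁ n₂) for |w| < 1. -/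
open scoped BigOperators

/-- The dilogarithm `Li₂(w) = ∑_{n ≥ 1} w^n / n²` for `|w| < 1`. -/
noncomputable def dilog (w : ℝ) : ℝ :=
  ∑' n : ℕ, w ^ (n + 1) / ((n : ℝ) + 1) ^ 2

/-- The double polylogarithm `Li_{1,1}(w) = ∑_{n₁ > n₂ > 0} w^{n₁} / (n₁ n₂)` for `|w| < 1`. -/
noncomputable def doublePolylog11 (w : ℝ) : ℝ :=
  ∑' p : {p : ℕ × ℕ // 0 < p.2 ∧ p.2 < p.1},
    w ^ p.1.1 / ((p.1.1 : ℝ) * (p.1.2 : ℝ))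

lemma aux_dilog_deriv (w : ℝ) (hw : |w| < 1) :
    HasDerivAt dilog (∑' n : ℕ, w ^ n / ((n : ℝ) + 1)) w := by
  obtain ⟨r, hr1, hr2⟩ := exists_between hw
  have hr0 : 0 ≤ r := (abs_nonneg w).trans hr1.le
  have := hasDerivAt_tsum_of_isPreconnected (𝕜 := ℝ) (u := fun n : ℕ => r ^ n)
    (g := fun (n : ℕ) (w : ℝ) => w ^ (n + 1) / ((n : ℝ) + 1) ^ 2)
    (g' := fun (n : ℕ) (w : ℝ) => w ^ n / ((n : ℝ) + 1))
    (t := Metric.ball 0 r) (y₀ := 0) (y := w)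
    (summable_geometric_of_lt_one hr0 hr2) Metric.isOpen_ball
    (convex_ball (0 : ℝ) r).isPreconnected
    (by
      intro n y _
      have h := (hasDerivAt_pow (n + 1) y).div_const (((n : ℝ) + 1) ^ 2)
      refine h.congr_deriv ?_
      have : (n : ℝ) + 1 ≠ 0 := by positivity
      rw [Nat.add_sub_cancel]
      push_cast
      field_simp)
    (by
      intro n y hy
      have hy' : |y| < r := by simpa using hy
      have hn : (1 : ℝ) ≤ (n : ℝ) + 1 := by
        have : (0 : ℝ) ≤ n := n.cast_nonneg
        linarith
      rw [Real.norm_eq_abs, abs_div, abs_pow, abs_of_pos (by linarith : (0 : ℝ) < (n : ℝ) + 1)]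
      calc |y| ^ n / ((n : ℝ) + 1) ≤ |y| ^ n := div_le_self (by positivity) hn
        _ ≤ r ^ n := by gcongr)
    (by simpa using (abs_nonneg w).trans_lt hr1)
    (by simpa using summable_zero)
    (by simpa using hr1)
  exact this

lemma aux_mul (w : ℝ) (hw : |w| < 1) :
    w * (∑' n : ℕ, w ^ n / ((n : ℝ) + 1)) = -Real.log (1 - w) := by
  rw [← tsum_mul_left, ← (Real.hasSum_pow_div_log_of_abs_lt_one hw).tsum_eq]
  congr 1
  ext n
  ring

/-- index bijection -/
def auxEquiv : ℕ × ℕ ≃ {p : ℕ × ℕ // 0 < p.2 ∧ p.2 < p.1} where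
  toFun q := ⟨(q.1 + 1 + (q.2 + 1), q.2 + 1), by constructor <;> simp <;> omega⟩
  invFun p := (p.1.1 - p.1.2 - 1, p.1.2 - 1)
  left_inv q := by ext <;> simp
  right_inv p := by
    obtain ⟨⟨a, b⟩, h1, h2⟩ := p
    simp only at h1 h2
    ext <;> simp <;> omega

lemma aux_double (w : ℝ) (hw : |w| < 1) :
    doublePolylog11 w = Real.log (1 - w) ^ 2 / 2 := by
  have h1 := Real.hasSum_pow_div_log_of_abs_lt_one hw
  have hg : Summable (fun n : ℕ => |w| ^ n) := summable_geometric_of_lt_one (abs_nonneg w) hw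
  have hn1 : ∀ n : ℕ, (1 : ℝ) ≤ (n : ℝ) + 1 := fun n => by
    have : (0 : ℝ) ≤ n := n.cast_nonneg
    linarith
  have hs1 : Summable (fun n : ℕ => ‖w ^ (n + 1) / ((n : ℝ) + 1)‖) := by
    refine Summable.of_nonneg_of_le (fun _ => norm_nonneg _) (fun n => ?_)
      ((summable_nat_add_iff 1).2 hg)
    rw [Real.norm_eq_abs, abs_div, abs_pow, abs_of_pos (by linarith [hn1 n] : (0 : ℝ) < (n : ℝ) + 1)]
    exact div_le_self (by positivity) (hn1 n)
  have hprod := tsum_mul_tsum_of_summable_norm hs1 hs1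
  rw [h1.tsum_eq] at hprod
  let F : ℕ × ℕ → ℝ := fun q =>
    w ^ (q.1 + 1 + (q.2 + 1)) / (((q.1 : ℝ) + 1 + (q.2 + 1)) * ((q.2 : ℝ) + 1))
  have hF : Summable F := by
    have hgg := Summable.mul_of_nonneg hg hg (fun _ => by positivity) (fun _ => by positivity)
    refine Summable.of_norm_bounded hgg (fun q => ?_)
    have a := hn1 q.1
    have b := hn1 q.2
    have hden : (1 : ℝ) ≤ ((q.1 : ℝ) + 1 + (q.2 + 1)) * ((q.2 : ℝ) + 1) := by nlinarith
    rw [Real.norm_eq_abs, abs_div, abs_pow, abs_of_pos (by linarith :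
      (0 : ℝ) < ((q.1 : ℝ) + 1 + (q.2 + 1)) * ((q.2 : ℝ) + 1))]
    refine (div_le_self (by positivity) hden).trans ?_
    rw [← pow_add]
    exact pow_le_pow_of_le_one (abs_nonneg w) hw.le (by omega)
  have hD : doublePolylog11 w = ∑' q, F q := by
    unfold doublePolylog11
    rw [← auxEquiv.tsum_eq]
    congr 1
    ext q
    simp [auxEquiv, F]
  have hswap : ∑' q : ℕ × ℕ, F q.swap = ∑' q, F q := (Equiv.prodComm ℕ ℕ).tsum_eq F
  have hFs : Summable (fun q : ℕ × ℕ => F q.swap) := (Equiv.prodComm ℕ ℕ).summable_iff.2 hF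
  have hsum := hF.tsum_add hFs
  have heq : (fun q : ℕ × ℕ => F q + F q.swap) = fun q : ℕ × ℕ =>
      w ^ (q.1 + 1) / ((q.1 : ℝ) + 1) * (w ^ (q.2 + 1) / ((q.2 : ℝ) + 1)) := by
    ext q
    have a : (q.1 : ℝ) + 1 ≠ 0 := by positivity
    have b : (q.2 : ℝ) + 1 ≠ 0 := by positivity
    have c : (q.1 : ℝ) + 1 + (q.2 + 1) ≠ 0 := by positivity
    have d : (q.2 : ℝ) + 1 + (q.1 + 1) ≠ 0 := by positivity
    simp only [F, Prod.fst_swap, Prod.snd_swap]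
    rw [div_add_div _ _ (mul_ne_zero c b) (mul_ne_zero d a), div_mul_div_comm,
      div_eq_div_iff (mul_ne_zero (mul_ne_zero c b) (mul_ne_zero d a)) (mul_ne_zero a b)]
    ring
  rw [heq, ← hprod, hswap] at hsum
  rw [hD]
  linarith

/-- Landen's formula for the dilogarithm: for `0 < z < 1/2`,
`Li₂(z) = -Li₂(z/(z-1)) - Li_{1,1}(z/(z-1))`. -/
theorem landen_dilog (z : ℝ) (hz0 : 0 < z) (hz : z < 1 / 2) :
    dilog z = -dilog (z / (z - 1)) - doublePolylog11 (z / (z - 1)) := by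
  have habs : ∀ x : ℝ, 0 ≤ x → x ≤ z → |x / (x - 1)| < 1 := by
    intro x h0 h1
    rw [abs_div, abs_of_nonneg h0, abs_of_neg (by linarith), div_lt_one (by linarith)]
    linarith
  have hlog : ∀ x : ℝ, x ≤ z → Real.log (1 - x / (x - 1)) = -Real.log (1 - x) := by
    intro x h1
    have : x - 1 ≠ 0 := by linarith
    have h' : 1 - x ≠ 0 := by linarith
    rw [← Real.log_inv]
    congr 1
    rw [eq_comm, inv_eq_iff_eq_inv, eq_comm, inv_eq_iff_eq_inv, eq_comm,
      inv_eq_iff_eq_inv]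
    field_simp
    ring
  have hder : ∀ x : ℝ, 0 ≤ x → x ≤ z →
      HasDerivAt (fun x => dilog x + dilog (x / (x - 1)) + Real.log (1 - x) ^ 2 / 2) 0 x := by
    intro x h0 h1
    have hx : |x| < 1 := by rw [abs_of_nonneg h0]; linarith
    have hne : x - 1 ≠ 0 := by linarith
    have hne' : 1 - x ≠ 0 := by linarith
    have d1 := aux_dilog_deriv x hx
    have dw : HasDerivAt (fun x : ℝ => x / (x - 1)) ((1 * (x - 1) - x * 1) / (x - 1) ^ 2) x :=
      (hasDerivAt_id x).div ((hasDerivAt_id x).sub_const 1) hne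
    have d2 := (aux_dilog_deriv _ (habs x h0 h1)).comp x dw
    have d3 := ((((hasDerivAt_id x).const_sub 1).log hne').pow 2).div_const 2
    refine ((d1.add d2).add d3).congr_deriv ?_
    have m1 := aux_mul x hx
    have m2 := aux_mul _ (habs x h0 h1)
    rw [hlog x h1] at m2
    rcases h0.eq_or_lt with rfl | hpos
    · simp
    · simp only [id]
      generalize (∑' n : ℕ, x ^ n / ((n : ℝ) + 1)) = A at *
      generalize (∑' n : ℕ, (x / (x - 1)) ^ n / ((n : ℝ) + 1)) = B at *
      generalize Real.log (1 - x) = L at *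
      have hA : A = -L / x := by field_simp; linarith
      have hB : B = L * (x - 1) / x := by
        field_simp at m2 ⊢
        linarith
      have hy : (1 - x) = -(x - 1) := by ring
      rw [hA, hB, hy]
      field_simp
      norm_num
      try ring
  have hc := constant_of_has_deriv_right_zero (a := 0) (b := z)
    (fun x hx => (hder x hx.1 hx.2).continuousAt.continuousWithinAt)
    (fun x hx => (hder x hx.1 hx.2.le).hasDerivWithinAt) z ⟨hz0.le, le_rfl⟩
  have hd0 : dilog 0 = 0 := by simp [dilog]
  simp only [zero_div, hd0, sub_zero, Real.log_one] at hc
  rw [aux_double _ (habs z hz0.le le_rfl), hlog z le_rfl]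
  linarith
end

section
/- Landen connection formula for polylogarithms: for every integer m ≥ 1 and every real z with 0 < z < 1/2, Li_m(z) = −∑_{j=1}^{m} ∑_{c} Li_c(z/(z−1)), where the inner sum ranges over all compositions c = (c₁,…,c_{m−j+1}) of m into m−j+1 positive integer parts (c₁+⋯+c_{m−j+1} = m). Equivalently, Li_m(z) = −∑_c Li_c(z/(z−1)) summed over all compositions c of m. -/
open scoped BigOperators

/-- The multiple polylogarithm `Li_{k₁,…,k_l}(w) = ∑_{n₁ > ⋯ > n_l > 0}
w^{n₁} / (n₁^{k₁} ⋯ n_l^{k_l})`, indexed by a list `k = [k₁, …, k_l]`;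
for the empty list it is the constant `1`. -/
noncomputable def MPL (k : List ℕ) (w : ℝ) : ℝ :=
  ∑' n : {n : Fin k.length → ℕ // StrictAnti n ∧ ∀ i, 0 < n i},
    (if h : 0 < k.length then w ^ (n.1 ⟨0, h⟩) else 1) /
      ∏ i, ((n.1 i : ℝ)) ^ (k.get i)


namespace Landen

lemma hasSum_congr {ι : Type*} {f g : ι → ℝ} {a : ℝ} (h : ∀ i, f i = g i) :
    HasSum f a ↔ HasSum g a := by
  rw [funext h]

noncomputable def G : List ℕ → ℕ → ℝ
  | [], _ => 1
  | k :: ks, N => ∑ n ∈ Finset.Ico 1 N, G ks n / (n : ℝ) ^ k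

noncomputable def coef : List ℕ → ℕ → ℝ
  | [], _ => 0
  | k :: ks, n => G ks n / (n : ℝ) ^ k

lemma G_nonneg (k : List ℕ) (N : ℕ) : 0 ≤ G k N := by
  induction k generalizing N with
  | nil => simp [G]
  | cons a t ih =>
    simp only [G]
    exact Finset.sum_nonneg fun n _ => div_nonneg (ih n) (by positivity)

lemma coef_nonneg (k : List ℕ) (N : ℕ) : 0 ≤ coef k N := by
  cases k with
  | nil => simp [coef]
  | cons a t => exact div_nonneg (G_nonneg t N) (by positivity)

open Classical in
noncomputable def V (k : List ℕ) (f : Fin k.length → ℕ) : ℝ :=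
  if StrictAnti f ∧ ∀ i, 0 < f i then (∏ i, ((f i : ℝ)) ^ (k.get i))⁻¹ else 0

lemma V_nonneg (k : List ℕ) (f) : 0 ≤ V k f := by
  unfold V
  split_ifs
  · positivity
  · exact le_rfl

lemma valid_cons {l : ℕ} (a : ℕ) (f : Fin l → ℕ) :
    (StrictAnti (Fin.cons a f : Fin (l+1) → ℕ) ∧ ∀ i, 0 < (Fin.cons a f : Fin (l+1) → ℕ) i) ↔
      (0 < a ∧ ∀ i, f i < a) ∧ (StrictAnti f ∧ ∀ i, 0 < f i) := by
  constructor
  · rintro ⟨h1, h2⟩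
    refine ⟨⟨by simpa using h2 0, fun i => ?_⟩, fun i j hij => ?_, fun i => ?_⟩
    · simpa using h1 (Fin.succ_pos i)
    · simpa using h1 (Fin.succ_lt_succ_iff.2 hij)
    · simpa using h2 i.succ
  · rintro ⟨⟨h1, h2⟩, h3, h4⟩
    refine ⟨fun i j hij => ?_, fun i => ?_⟩
    · induction j using Fin.cases with
      | zero => exact absurd hij (Fin.not_lt_zero i)
      | succ j =>
        induction i using Fin.cases with
        | zero => simpa using h2 j
        | succ i => simpa using h3 (Fin.succ_lt_succ_iff.1 hij)
    · induction i using Fin.cases with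
      | zero => simpa using h1
      | succ i => simpa using h4 i

open Classical in
lemma V_cons (k : ℕ) (ks : List ℕ) (a : ℕ) (f : Fin ks.length → ℕ) :
    V (k :: ks) (Fin.cons a f : Fin (ks.length + 1) → ℕ) =
      (if 0 < a then ((a : ℝ) ^ k)⁻¹ else 0) * (if ∀ i, f i < a then V ks f else 0) := by
  have e : (∏ i : Fin (k :: ks).length, (((Fin.cons a f : Fin (ks.length + 1) → ℕ) i : ℝ)) ^ ((k :: ks).get i))
      = (a : ℝ) ^ k * ∏ i, ((f i : ℝ)) ^ (ks.get i) := by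
    exact (Fin.prod_univ_succ (n := ks.length) _)
  unfold V
  rw [e]
  have := valid_cons a f
  refine (if_congr this rfl rfl).trans ?_
  by_cases h1 : 0 < a
  · by_cases h2 : ∀ i, f i < a
    · by_cases h3 : (StrictAnti f ∧ ∀ i, 0 < f i)
      · rw [if_pos ⟨⟨h1, h2⟩, h3⟩, if_pos h1, if_pos h2, if_pos h3, mul_inv]
      · rw [if_neg (fun h => h3 h.2), if_neg h3, ite_self, mul_zero]
    · rw [if_neg (fun h => h2 h.1.2), if_neg h2, mul_zero]
  · rw [if_neg (fun h => h1 h.1.1), if_neg h1, zero_mul]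

open Classical in
lemma step (ks : List ℕ) (h : ℕ → ℝ)
    (H : ∀ N, HasSum (fun f => if ∀ i, f i < N then V ks f else 0) (G ks N))
    (hs : Summable fun n => |h n| * G ks n) :
    HasSum (fun p : ℕ × (Fin ks.length → ℕ) => h p.1 * (if ∀ i, p.2 i < p.1 then V ks p.2 else 0))
      (∑' n, h n * G ks n) := by
  have hS : Summable (fun p : ℕ × (Fin ks.length → ℕ) => h p.1 * (if ∀ i, p.2 i < p.1 then V ks p.2 else 0)) := by
    apply Summable.of_norm
    rw [summable_prod_of_nonneg (fun _ => norm_nonneg _)]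
    have e : ∀ n, HasSum (fun f : Fin ks.length → ℕ => ‖h n * (if ∀ i, f i < n then V ks f else 0)‖) (|h n| * G ks n) := by
      intro n
      refine (hasSum_congr fun f => ?_).mpr ((H n).mul_left |h n|)
      rw [norm_mul, Real.norm_eq_abs, Real.norm_eq_abs]
      congr 1
      apply abs_of_nonneg
      split_ifs
      · exact V_nonneg _ _
      · exact le_rfl
    refine ⟨fun n => (e n).summable, ?_⟩
    convert hs using 2 with n
    exact (e n).tsum_eq
  have e2 := hS.tsum_prod
  simp only [fun n => ((H n).mul_left (h n)).tsum_eq] at e2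
  rw [← e2]
  exact hS.hasSum

open Classical in
lemma claim (ks : List ℕ) : ∀ N, HasSum (fun f => if ∀ i, f i < N then V ks f else 0) (G ks N) := by
  induction ks with
  | nil =>
    intro N
    have : Unique (Fin ([] : List ℕ).length → ℕ) := inferInstanceAs (Unique (Fin 0 → ℕ))
    have key := hasSum_unique (fun f : Fin ([] : List ℕ).length → ℕ => if ∀ i, f i < N then V [] f else 0)
    have h1 : StrictAnti (default : Fin ([] : List ℕ).length → ℕ) := fun i => i.elim0
    have h2 : ∀ i, 0 < (default : Fin ([] : List ℕ).length → ℕ) i := fun i => i.elim0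
    have h3 : ∀ i, (default : Fin ([] : List ℕ).length → ℕ) i < N := fun i => i.elim0
    have e : (fun f : Fin ([] : List ℕ).length → ℕ => if ∀ i, f i < N then V [] f else 0) default = G [] N := by
      refine (if_pos h3).trans ?_
      rw [V, if_pos ⟨h1, h2⟩]
      simp [G]
    rw [← e]
    exact key
  | cons k ks ih =>
    intro N
    set h : ℕ → ℝ := fun n => if n ∈ Finset.Ico 1 N then ((n : ℝ) ^ k)⁻¹ else 0 with hh
    have h0 : ∀ n ∉ Finset.Ico 1 N, h n = 0 := fun n hn => by simp only [hh, if_neg hn]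
    have st := step ks h ih (summable_of_ne_finset_zero (s := Finset.Ico 1 N) (fun n hn => by simp [h0 n hn]))
    rw [tsum_eq_sum (s := Finset.Ico 1 N) (fun n hn => by simp [h0 n hn])] at st
    refine (Fin.consEquiv (fun _ : Fin (ks.length + 1) => ℕ)).hasSum_iff.1 ?_
    have eG : ∑ b ∈ Finset.Ico 1 N, h b * G ks b = G (k :: ks) N := by
      simp only [G]
      refine Finset.sum_congr rfl fun n hn => ?_
      simp only [hh, if_pos hn]
      rw [div_eq_mul_inv, mul_comm]
    rw [← eG]
    refine (hasSum_congr ?_).mpr st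
    · rintro ⟨a, f⟩
      change (if ∀ i, (Fin.cons a f : Fin (ks.length + 1) → ℕ) i < N then V (k :: ks) (Fin.cons a f : Fin (ks.length + 1) → ℕ) else 0) = _
      have := V_cons k ks a f
      rw [this]
      have hc : (∀ i, (Fin.cons a f : Fin (ks.length + 1) → ℕ) i < N) ↔ a < N ∧ ∀ i, f i < N := by
        rw [Fin.forall_fin_succ]; simp
      simp only [hc, hh, Finset.mem_Ico]
      by_cases h1 : a < N
      · by_cases h2 : ∀ i, f i < a
        · have h3 : ∀ i, f i < N := fun i => (h2 i).trans h1
          simp [h1, h2, h3, Nat.pos_iff_ne_zero, Nat.one_le_iff_ne_zero]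
        · simp [h2]
      · simp [h1]

lemma MPL_eq (k : ℕ) (hk : 0 < k) (ks : List ℕ) (w : ℝ) (hs : Summable fun n => |w| ^ n * coef (k :: ks) n) :
    MPL (k :: ks) w = ∑' n, w ^ n * coef (k :: ks) n := by
  classical
  have st := step ks (fun n => w ^ n * ((n : ℝ) ^ k)⁻¹) (claim ks) (by
    convert hs using 2 with n
    rw [abs_mul, abs_pow, abs_of_nonneg (show (0:ℝ) ≤ ((n : ℝ) ^ k)⁻¹ by positivity)]
    simp only [coef]; ring)
  have e : ∀ n : ℕ, w ^ n * ((n : ℝ) ^ k)⁻¹ * G ks n = w ^ n * coef (k :: ks) n := by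
    intro n; simp only [coef]; ring
  simp only [e] at st
  rw [← st.tsum_eq]
  unfold MPL
  rw [← (Fin.consEquiv (fun _ : Fin (ks.length + 1) => ℕ)).symm.tsum_eq]
  refine (tsum_subtype {n : Fin (k :: ks).length → ℕ | StrictAnti n ∧ ∀ i, 0 < n i} (fun n => (if h : 0 < (k :: ks).length then w ^ (n ⟨0, h⟩) else 1) /
      ∏ i, ((n i : ℝ)) ^ ((k :: ks).get i))).trans ?_
  apply tsum_congr
  intro f
  obtain ⟨⟨a, f⟩, rfl⟩ := (Fin.consEquiv (fun _ : Fin (ks.length + 1) => ℕ)).surjective f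
  rw [Equiv.symm_apply_apply]
  have hv := V_cons k ks a f
  have : w ^ a * ((a : ℝ) ^ k)⁻¹ = w ^ a * (if 0 < a then ((a : ℝ) ^ k)⁻¹ else 0) := by
    split_ifs with h
    · rfl
    · have : a = 0 := by omega
      simp [this, hk.ne']
  simp only [this]
  rw [mul_assoc, ← hv, V, Set.indicator_apply]
  by_cases h1 : StrictAnti (Fin.cons a f : Fin (ks.length + 1) → ℕ) ∧
      ∀ i : Fin (k :: ks).length, 0 < (Fin.cons a f : Fin (ks.length + 1) → ℕ) i
  · refine (if_pos h1).trans ?_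
    erw [if_pos h1]
    rw [dif_pos (show 0 < (k :: ks).length from Nat.succ_pos _),
      div_eq_mul_inv]
    rfl
  · refine (if_neg h1).trans ?_
    erw [if_neg h1]
    rw [mul_zero]

end Landen
namespace Landen

def inc : List ℕ → List ℕ
  | [] => []
  | k :: ks => (k + 1) :: ks

def D : ℕ → Finset (List ℕ)
  | 0 => {[1]}
  | m + 1 => (D m).image (fun l => 1 :: l) ∪ (D m).image inc

lemma mem_D (m : ℕ) : ∀ l : List ℕ, l ∈ D m ↔ (∀ i ∈ l, 0 < i) ∧ l.sum = m + 1 := by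
  induction m with
  | zero =>
    intro l
    simp only [D, Finset.mem_singleton]
    constructor
    · rintro rfl; simp
    · rintro ⟨h, hs⟩
      match l, h, hs with
      | [], _, hs => simp at hs
      | [a], _, hs => simpa using hs
      | a :: b :: t, h, hs =>
        have h1 := h a (by simp)
        have h2 := h b (by simp)
        simp at hs
        omega
  | succ m ih =>
    intro l
    simp only [D, Finset.mem_union, Finset.mem_image, ih]
    constructor
    · rintro (⟨l, ⟨h, hs⟩, rfl⟩ | ⟨l, ⟨h, hs⟩, rfl⟩)
      · refine ⟨by simpa using h, ?_⟩
        simp [hs]; omega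
      · cases l with
        | nil => simp at hs
        | cons a t =>
          simp [inc] at h hs ⊢
          refine ⟨h.2, by omega⟩
    · rintro ⟨h, hs⟩
      match l, h, hs with
      | [], _, hs => simp at hs
      | 0 :: t, h, _ => simp at h
      | 1 :: t, h, hs =>
        left
        refine ⟨t, ⟨fun i hi => h i (by simp [hi]), ?_⟩, rfl⟩
        simp at hs; omega
      | (a + 2) :: t, h, hs =>
        right
        refine ⟨(a + 1) :: t, ⟨?_, ?_⟩, rfl⟩
        · simp at h ⊢; exact h
        · simp at hs ⊢; omega

lemma sum_D_succ (m : ℕ) (φ : List ℕ → ℝ) :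
    ∑ l ∈ D (m + 1), φ l = ∑ l ∈ D m, (φ (1 :: l) + φ (inc l)) := by
  have hne : ∀ l ∈ D m, ∃ a t, l = (a + 1) :: t := by
    intro l hl
    rw [mem_D] at hl
    match l, hl with
    | [], hl => simp at hl
    | 0 :: t, hl => simp at hl
    | (a + 1) :: t, _ => exact ⟨a, t, rfl⟩
  rw [D, Finset.sum_union, Finset.sum_image, Finset.sum_image, Finset.sum_add_distrib]
  · intro x hx y hy hxy
    obtain ⟨a, t, rfl⟩ := hne x hx
    obtain ⟨b, s, rfl⟩ := hne y hy
    simpa [inc] using hxy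
  · intro x _ y _ hxy
    simpa using hxy
  · rw [Finset.disjoint_left]
    intro l h1 h2
    rw [Finset.mem_image] at h1 h2
    obtain ⟨x, hx, rfl⟩ := h1
    obtain ⟨y, hy, hxy⟩ := h2
    obtain ⟨b, s, rfl⟩ := hne y hy
    simp [inc] at hxy

lemma sum_comp (m : ℕ) (φ : List ℕ → ℝ) :
    ∑ c : Composition (m + 1), φ c.blocks = ∑ l ∈ D m, φ l := by
  refine Finset.sum_bij (fun c _ => c.blocks) ?_ ?_ ?_ ?_
  · intro c _
    rw [mem_D]
    exact ⟨fun i hi => c.blocks_pos hi, c.blocks_sum⟩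
  · intro c _ d _ h
    exact Composition.ext h
  · intro l hl
    rw [mem_D] at hl
    exact ⟨⟨l, fun {i} hi => hl.1 i hi, hl.2⟩, Finset.mem_univ _, rfl⟩
  · intros; rfl

noncomputable def A (m n : ℕ) : ℝ := ∑ l ∈ D m, coef l n

lemma A_zero (n : ℕ) : A 0 n = 1 / n := by
  simp [A, D, coef, G]

lemma A_succ (m n : ℕ) (hn : 0 < n) : A (m + 1) n = (∑ j ∈ Finset.range n, A m (j + 1)) / n := by
  unfold A
  rw [sum_D_succ, Finset.sum_comm, Finset.sum_div]
  refine Finset.sum_congr rfl fun l hl => ?_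
  cases l with
  | nil => rw [mem_D] at hl; simp at hl
  | cons k ks =>
    obtain ⟨n, rfl⟩ : ∃ k, n = k + 1 := ⟨n - 1, by omega⟩
    rw [Finset.sum_range_succ]
    simp only [coef, inc, G]
    rw [Finset.sum_Ico_eq_sum_range]
    simp only [Nat.add_sub_cancel, add_comm 1]
    have : ((n + 1 : ℕ) : ℝ) ≠ 0 := by positivity
    rw [add_div, pow_one, pow_succ, div_div]

lemma A_le (m n : ℕ) (hn : 0 < n) : A m n ≤ 1 := by
  induction m generalizing n with
  | zero =>
    rw [A_zero, div_le_one (by positivity)]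
    exact_mod_cast hn
  | succ m ih =>
    rw [A_succ _ _ hn, div_le_one (by positivity)]
    calc _ ≤ ∑ j ∈ Finset.range n, (1:ℝ) := Finset.sum_le_sum fun j _ => ih _ (by omega)
      _ = n := by simp

lemma A_nonneg (m n : ℕ) : 0 ≤ A m n := Finset.sum_nonneg fun l _ => coef_nonneg l n

/-- alternating binomial identity -/
lemma T_step (b : ℕ → ℝ) (c : ℕ → ℝ) (hb0 : b 0 = 0) (hb : ∀ n, b (n + 1) - b n = c n) (k : ℕ) :
    ∑ n ∈ Finset.range (k + 1), (-1 : ℝ) ^ n * (k.choose n) * c n =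
      ∑ n ∈ Finset.range (k + 1), (-1 : ℝ) ^ n * ((k + 1).choose (n + 1)) * b (n + 1) := by
  have h1 : ∀ n, (-1 : ℝ) ^ n * (k.choose n) * c n =
      (-1 : ℝ) ^ n * ((k + 1).choose (n + 1)) * b (n + 1)
       + ((-1 : ℝ) ^ (n+1) * (k.choose (n + 1)) * b (n + 1) - (-1 : ℝ) ^ n * (k.choose n) * b n) := by
    intro n
    rw [← hb, Nat.choose_succ_succ]; push_cast; ring
  rw [Finset.sum_congr rfl fun n _ => h1 n, Finset.sum_add_distrib,
    Finset.sum_range_sub (fun n => (-1 : ℝ) ^ n * (k.choose n) * b n)]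
  simp [hb0]

lemma T_aux (m k : ℕ) : ((k:ℝ) + 1) * ∑ n ∈ Finset.range (k + 1), (-1 : ℝ) ^ n * (k.choose n) * A m (n + 1) =
    ∑ n ∈ Finset.range (k + 1), (-1 : ℝ) ^ n * ((k + 1).choose (n + 1)) * ((n + 1 : ℕ) * A m (n + 1)) := by
  rw [Finset.mul_sum]
  refine Finset.sum_congr rfl fun n _ => ?_
  have := Nat.add_one_mul_choose_eq k n
  have h : ((k:ℝ) + 1) * k.choose n = (k+1).choose (n+1) * ((n + 1 : ℕ) : ℝ) := by exact_mod_cast this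
  linear_combination (-1 : ℝ) ^ n * A m (n + 1) * h

lemma T_eq (m k : ℕ) : ∑ n ∈ Finset.range (k + 1), (-1 : ℝ) ^ n * (k.choose n) * A m (n + 1) =
    1 / ((k:ℝ) + 1) ^ (m + 1) := by
  have hk : (k:ℝ) + 1 ≠ 0 := by positivity
  induction m with
  | zero =>
    have h := T_aux 0 k
    have h2 := T_step (fun n => if n = 0 then 0 else 1) (fun n => if n = 0 then 1 else 0) (by simp)
      (fun n => by by_cases h : n = 0 <;> simp [h]) k
    have h3 : ∑ n ∈ Finset.range (k + 1), (-1 : ℝ) ^ n * ((k + 1).choose (n + 1)) * ((n + 1 : ℕ) * A 0 (n + 1)) = 1 := by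
      have e : ∀ n : ℕ, ((n + 1 : ℕ) : ℝ) * A 0 (n + 1) = 1 := fun n => by
        rw [A_zero]; field_simp
      simp only [e]
      simp at h2
      simpa using h2.symm
    rw [h3] at h
    rw [zero_add, pow_one, eq_div_iff hk, mul_comm]
    exact h
  | succ m ih =>
    have h := T_aux (m + 1) k
    rw [← T_step (fun n => n * A (m + 1) n) (fun n => A m (n + 1)) (by simp) _ k, ih] at h
    · rw [pow_succ, ← div_div, eq_div_iff hk, ← h, mul_comm]
    · intro n
      have e : ∀ n : ℕ, (n : ℝ) * A (m + 1) n = ∑ j ∈ Finset.range n, A m (j + 1) := by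
        intro n
        rcases Nat.eq_zero_or_pos n with rfl | hn
        · simp
        · rw [A_succ _ _ hn]; field_simp
      rw [e, e, Finset.sum_range_succ]; ring

lemma geom (z : ℝ) (hz0 : 0 < z) (hz : z < 1 / 2) (n : ℕ) :
    HasSum (fun k => (k.choose n : ℝ) * z ^ (k + 1)) ((z / (1 - z)) ^ (n + 1)) := by
  have h := hasSum_choose_mul_geometric_of_norm_lt_one n (r := z) (by
    rw [Real.norm_eq_abs, abs_of_pos hz0]; linarith)
  have hi : Function.Injective (fun j : ℕ => j + n) := add_left_injective n
  rw [← hi.hasSum_iff]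
  · have e : (z / (1 - z)) ^ (n + 1) = z ^ (n + 1) * (1 / (1 - z) ^ (n + 1)) := by
      rw [div_pow]; ring
    rw [e]
    refine (hasSum_congr fun j => ?_).mpr (h.mul_left (z ^ (n + 1)))
    simp only [Function.comp]; ring
  · intro k hk
    have : k < n := by
      by_contra hc
      exact hk ⟨k - n, by simp; omega⟩
    simp [Nat.choose_eq_zero_of_lt this]

lemma analytic (m : ℕ) (z : ℝ) (hz0 : 0 < z) (hz : z < 1 / 2) :
    ∑' k : ℕ, z ^ (k + 1) / ((k:ℝ) + 1) ^ (m + 1) = -∑' n : ℕ, (z / (z - 1)) ^ (n + 1) * A m (n + 1) := by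
  have h1z : 0 < 1 - z := by linarith
  have hq : z / (1 - z) < 1 := by rw [div_lt_one h1z]; linarith
  have hq0 : 0 < z / (1 - z) := by positivity
  let F : ℕ → ℕ → ℝ := fun n k => (-1) ^ n * A m (n + 1) * ((k.choose n : ℝ) * z ^ (k + 1))
  have hF : ∀ n, HasSum (F n) ((-1) ^ n * A m (n + 1) * (z / (1 - z)) ^ (n + 1)) :=
    fun n => (geom z hz0 hz n).mul_left _
  have hS : Summable (Function.uncurry F) := by
    apply Summable.of_norm
    rw [summable_prod_of_nonneg (fun _ => norm_nonneg _)]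
    have e : ∀ n, HasSum (fun k => ‖F n k‖) (A m (n + 1) * (z / (1 - z)) ^ (n + 1)) := by
      intro n
      refine (hasSum_congr fun k => ?_).mpr ((geom z hz0 hz n).mul_left (A m (n + 1)))
      simp only [F]
      rw [norm_mul, norm_mul, norm_pow, norm_neg, norm_one, one_pow, one_mul,
        Real.norm_of_nonneg (A_nonneg _ _), Real.norm_of_nonneg (by positivity)]
    refine ⟨fun n => (e n).summable, ?_⟩
    simp only [Function.uncurry, fun n => (e n).tsum_eq]
    refine Summable.of_nonneg_of_le (fun n => mul_nonneg (A_nonneg _ _) (by positivity))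
      (fun n => mul_le_mul_of_nonneg_right (A_le m _ (Nat.succ_pos n)) (by positivity)) ?_
    simp only [one_mul]
    exact (summable_nat_add_iff 1).2 (summable_geometric_of_lt_one hq0.le hq)
  have hc := hS.tsum_comm
  simp only [fun n => (hF n).tsum_eq] at hc
  have hl : ∀ k, ∑' n, F n k = z ^ (k + 1) / ((k:ℝ) + 1) ^ (m + 1) := by
    intro k
    rw [tsum_eq_sum (s := Finset.range (k + 1))]
    · rw [div_eq_mul_one_div, ← T_eq, Finset.mul_sum]
      refine Finset.sum_congr rfl fun n _ => ?_
      simp only [F]; ring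
    · intro n hn
      simp only [Finset.mem_range, not_lt] at hn
      simp [F, Nat.choose_eq_zero_of_lt (show k < n by omega)]
  simp only [hl] at hc
  rw [hc, ← tsum_neg]
  refine tsum_congr fun n => ?_
  have : z / (z - 1) = - (z / (1 - z)) := by rw [← neg_sub 1 z, div_neg]
  rw [this, neg_pow (z / (1 - z)), pow_succ]; ring

lemma coef_le (m : ℕ) (l : List ℕ) (hl : l ∈ D m) (n : ℕ) : coef l n ≤ A m n :=
  Finset.single_le_sum (f := fun l => coef l n) (fun l _ => coef_nonneg l n) hl

lemma coef_at_zero (m : ℕ) (l : List ℕ) (hl : l ∈ D m) : coef l 0 = 0 := by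
  rw [mem_D] at hl
  cases l with
  | nil => simp at hl
  | cons k ks =>
    have : 0 < k := hl.1 k (by simp)
    simp [coef, this.ne']

lemma summ (m : ℕ) (l : List ℕ) (hl : l ∈ D m) (w : ℝ) (hw : |w| < 1) :
    Summable fun n => |w| ^ n * coef l n := by
  refine Summable.of_nonneg_of_le (fun n => mul_nonneg (by positivity) (coef_nonneg _ _)) (fun n => ?_)
    (summable_geometric_of_lt_one (abs_nonneg w) hw)
  rcases Nat.eq_zero_or_pos n with rfl | hn
  · simp [coef_at_zero m l hl]
  · exact mul_le_of_le_one_right (by positivity) ((coef_le m l hl n).trans (A_le m n hn))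

lemma MPL_hasSum (m : ℕ) (l : List ℕ) (hl : l ∈ D m) (w : ℝ) (hw : |w| < 1) :
    HasSum (fun n : ℕ => w ^ (n + 1) * coef l (n + 1)) (MPL l w) := by
  have hs := summ m l hl w hw
  have hs' : Summable fun n => w ^ n * coef l n := by
    apply Summable.of_norm
    convert hs using 2 with n
    rw [norm_mul, norm_pow, Real.norm_of_nonneg (coef_nonneg _ _), Real.norm_eq_abs]
  have e : MPL l w = ∑' n, w ^ n * coef l n := by
    have hl' := (mem_D m l).1 hl
    cases l with
    | nil => simp at hl'
    | cons k ks => exact MPL_eq k (hl'.1 k (by simp)) ks w hs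
  have := hs'.hasSum
  rw [← e, ← hasSum_nat_add_iff' 1] at this
  simpa [coef_at_zero m l hl] using this

end Landen

/-- Landen connection formula for polylogarithms: for `m ≥ 1` and `0 < z < 1/2`,
`Li_m(z) = -∑_c Li_c(z/(z-1))`, the sum ranging over all compositions `c` of `m`
(equivalently, over `1 ≤ j ≤ m` and all compositions of `m` into `m - j + 1` parts). -/
theorem landen_connection_polylog (m : ℕ) (hm : 1 ≤ m) (z : ℝ)
    (hz0 : 0 < z) (hz : z < 1 / 2) :
    MPL [m] z = -∑ c : Composition m, MPL c.blocks (z / (z - 1)) := by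
  obtain ⟨m, rfl⟩ : ∃ k, m = k + 1 := ⟨m - 1, by omega⟩
  have hw : |z / (z - 1)| < 1 := by
    rw [abs_div, abs_of_pos hz0, abs_of_neg (by linarith), div_lt_one (by linarith)]
    linarith
  rw [Landen.sum_comp m (fun l => MPL l (z / (z - 1)))]
  have h1 := Landen.MPL_hasSum m [m + 1] (by rw [Landen.mem_D]; simp) z
    (by rw [abs_of_pos hz0]; linarith)
  have h2 := hasSum_sum (fun l hl => Landen.MPL_hasSum m l hl (z / (z - 1)) hw)
  simp only [← Finset.mul_sum] at h2
  rw [← h1.tsum_eq, ← h2.tsum_eq]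
  have h3 := Landen.analytic m z hz0 hz
  unfold Landen.A at h3
  rw [← h3]
  refine tsum_congr fun n => ?_
  simp [Landen.coef, Landen.G]
  ring
end

section
/- For every integer k ≥ 2, every integer j with 0 ≤ j ≤ k−1, and every real λ < 0, ∫₀¹ Li_{k−j}(z) · ((−log z)^j / j!) · z^{−λ−1} dz = ∑_{n=1}^{∞} 1 / ( n^{k−j} (n−λ)^{j+1} ). -/
open scoped BigOperators

/-- The polylogarithm `Li_k(z) = ∑_{n ≥ 1} z^n / n^k`. -/
noncomputable def polylog (k : ℕ) (z : ℝ) : ℝ :=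
  ∑' n : ℕ, z ^ (n + 1) / ((n : ℝ) + 1) ^ k

theorem aux_image : (fun t : ℝ => Real.exp (-t)) '' Set.Ioi 0 = Set.Ioo 0 1 := by
  ext z
  constructor
  · rintro ⟨t, ht, rfl⟩
    have ht : 0 < t := ht
    exact ⟨Real.exp_pos _, by simpa using ht⟩
  · rintro ⟨h0, h1⟩
    refine ⟨-Real.log z, ?_, ?_⟩
    · have := Real.log_neg h0 h1
      simpa using this
    · simp [Real.exp_log h0]

theorem aux_deriv : ∀ x ∈ Set.Ioi (0:ℝ),
    HasDerivWithinAt (fun t : ℝ => Real.exp (-t)) (-Real.exp (-x)) (Set.Ioi 0) x := by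
  intro x _
  have := ((hasDerivAt_id x).neg.exp).hasDerivWithinAt (s := Set.Ioi 0)
  simpa using this

theorem aux_inj : Set.InjOn (fun t : ℝ => Real.exp (-t)) (Set.Ioi 0) := by
  intro a _ b _ h
  simpa using h

theorem aux_congr (j : ℕ) (s : ℝ) : Set.EqOn
    (fun t : ℝ => |-Real.exp (-t)| • ((-Real.log (Real.exp (-t))) ^ j * (Real.exp (-t)) ^ (s - 1)))
    (fun t : ℝ => t ^ (((j:ℝ) + 1) - 1) * Real.exp (-(s * t))) (Set.Ioi 0) := by
  intro t _
  simp only [abs_neg, abs_of_pos (Real.exp_pos _), Real.log_exp, neg_neg, smul_eq_mul,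
    add_sub_cancel_right, Real.rpow_natCast]
  rw [← Real.exp_mul, mul_left_comm, ← Real.exp_add]
  ring_nf

theorem aux_int (j : ℕ) (s : ℝ) (hs : 0 < s) : MeasureTheory.IntegrableOn
    (fun z : ℝ => (-Real.log z) ^ j * z ^ (s - 1)) (Set.Ioo 0 1) := by
  rw [← aux_image, MeasureTheory.integrableOn_image_iff_integrableOn_abs_deriv_smul
    measurableSet_Ioi aux_deriv aux_inj]
  rw [MeasureTheory.integrableOn_congr_fun (aux_congr j s) measurableSet_Ioi]
  have := integrableOn_rpow_mul_exp_neg_mul_rpow (p := 1) (s := (j:ℝ) + 1 - 1) (b := s)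
    (by have : (0:ℝ) ≤ j := j.cast_nonneg
        linarith) one_pos hs
  simpa using this

theorem aux_val (j : ℕ) (s : ℝ) (hs : 0 < s) :
    ∫ z in Set.Ioo (0:ℝ) 1, (-Real.log z) ^ j * z ^ (s - 1) = j.factorial / s ^ (j + 1) := by
  rw [← aux_image, MeasureTheory.integral_image_eq_integral_abs_deriv_smul
    measurableSet_Ioi aux_deriv aux_inj]
  rw [MeasureTheory.setIntegral_congr_fun measurableSet_Ioi (aux_congr j s)]
  rw [Real.integral_rpow_mul_exp_neg_mul_Ioi (by positivity) hs, Real.Gamma_nat_eq_factorial]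
  have : (j:ℝ) + 1 = ((j + 1 : ℕ) : ℝ) := by push_cast; rfl
  rw [this, Real.rpow_natCast]
  simp; ring

/-- For `k ≥ 2`, `0 ≤ j ≤ k - 1` and `λ < 0`,
`∫₀¹ Li_{k-j}(z) · (-log z)^j / j! · z^{-λ-1} dz = ∑_{n ≥ 1} 1/(n^{k-j} (n-λ)^{j+1})`. -/
theorem mellin_polylog_term (k j : ℕ) (hk : 2 ≤ k) (hj : j ≤ k - 1)
    (lam : ℝ) (hlam : lam < 0) :
    (∫ z in Set.Ioo (0 : ℝ) 1,
        polylog (k - j) z * ((-Real.log z) ^ j / (Nat.factorial j : ℝ)) *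
          z ^ (-lam - 1))
      = ∑' n : ℕ, 1 / (((n : ℝ) + 1) ^ (k - j) * (((n : ℝ) + 1) - lam) ^ (j + 1)) := by
  have hpos : ∀ n : ℕ, 0 < (n:ℝ) + 1 - lam := fun n => by
    have : (0:ℝ) ≤ n := n.cast_nonneg
    linarith
  let F : ℕ → ℝ → ℝ := fun n z => (1 / (((n:ℝ) + 1) ^ (k - j) * (j.factorial : ℝ))) *
    ((-Real.log z) ^ j * z ^ (((n:ℝ) + 1 - lam) - 1))
  have hint : ∀ n, MeasureTheory.Integrable (F n)
      (MeasureTheory.volume.restrict (Set.Ioo (0:ℝ) 1)) := fun n =>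
    (aux_int j _ (hpos n)).const_mul _
  have hval : ∀ n, ∫ z in Set.Ioo (0:ℝ) 1, F n z =
      1 / (((n : ℝ) + 1) ^ (k - j) * (((n : ℝ) + 1) - lam) ^ (j + 1)) := fun n => by
    simp only [F]
    rw [MeasureTheory.integral_const_mul, aux_val j _ (hpos n)]
    have h1 : (j.factorial : ℝ) ≠ 0 := by positivity
    have h2 := (hpos n).ne'
    field_simp
  have hnorm : ∀ n, ∫ z in Set.Ioo (0:ℝ) 1, ‖F n z‖ =
      1 / (((n : ℝ) + 1) ^ (k - j) * (((n : ℝ) + 1) - lam) ^ (j + 1)) := fun n => by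
    rw [← hval n]
    refine MeasureTheory.setIntegral_congr_fun measurableSet_Ioo ?_
    intro z hz
    have hl : 0 ≤ -Real.log z := by
      have := Real.log_neg hz.1 hz.2
      linarith
    have hz0 := hz.1
    simp only [F]
    exact Real.norm_of_nonneg (by positivity)
  have hsum : Summable fun n => ∫ z in Set.Ioo (0:ℝ) 1, ‖F n z‖ := by
    simp only [hnorm]
    have hs : Summable fun n : ℕ => 1 / ((n:ℝ) + 1) ^ (k + 1) := by
      have := (summable_nat_add_iff 1).2
        ((Real.summable_one_div_nat_pow (p := k + 1)).2 (by omega))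
      simpa using this
    refine Summable.of_nonneg_of_le (fun n => ?_) (fun n => ?_) hs
    · have := hpos n
      positivity
    · have h1 : ((n:ℝ) + 1) ^ (k + 1) = ((n:ℝ) + 1) ^ (k - j) * ((n:ℝ) + 1) ^ (j + 1) := by
        rw [← pow_add]
        congr 1
        omega
      rw [h1]
      have : (n:ℝ) + 1 ≤ (n:ℝ) + 1 - lam := by linarith
      gcongr
  have key := MeasureTheory.hasSum_integral_of_summable_integral_norm hint hsum
  simp only [hval] at key
  rw [key.tsum_eq]
  refine MeasureTheory.setIntegral_congr_fun measurableSet_Ioo ?_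
  intro z hz
  simp only [polylog, F]
  rw [← tsum_mul_right, ← tsum_mul_right]
  refine tsum_congr fun n => ?_
  have e : (n:ℝ) + 1 - lam - 1 = ((n + 1 : ℕ) : ℝ) + (-lam - 1) := by push_cast; ring
  rw [e, Real.rpow_add hz.1, Real.rpow_natCast]
  field_simp
end

section
/- For every real λ < 1, ∑_{n=1}^{∞} 1/( n² (n−λ) ) = ∑_{n₁>n₂>0} 1/( n₁ (n₁−λ)(n₂−λ) ), where the right-hand sum ranges over pairs of positive integers n₁ > n₂. -/
open scoped BigOperators

noncomputable def mlC (l : ℝ) (a b : ℕ) : ℝ :=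
  Real.Gamma (a + 1 - l) * Real.Gamma (b + 1 - l) / (Real.Gamma (a + b + 1 - l) * Real.Gamma (1 - l))

lemma mlC_symm (l : ℝ) (a b : ℕ) : mlC l a b = mlC l b a := by
  unfold mlC
  rw [add_comm (a : ℝ) b, mul_comm (Real.Gamma (a + 1 - l))]

lemma mlC_pos (l : ℝ) (hl : l < 1) (a b : ℕ) : 0 < mlC l a b := by
  unfold mlC
  have ha : (0 : ℝ) ≤ a := a.cast_nonneg
  have hb : (0 : ℝ) ≤ b := b.cast_nonneg
  have h1 := Real.Gamma_pos_of_pos (show 0 < (a : ℝ) + 1 - l by linarith)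
  have h2 := Real.Gamma_pos_of_pos (show 0 < (b : ℝ) + 1 - l by linarith)
  have h3 := Real.Gamma_pos_of_pos (show 0 < (a : ℝ) + b + 1 - l by linarith)
  have h4 := Real.Gamma_pos_of_pos (show 0 < 1 - l by linarith)
  positivity

lemma mlC_zero (l : ℝ) (hl : l < 1) (b : ℕ) : mlC l 0 b = 1 := by
  unfold mlC
  have hb : (0 : ℝ) ≤ b := b.cast_nonneg
  have h2 := Real.Gamma_pos_of_pos (show 0 < (b : ℝ) + 1 - l by linarith)
  have h4 := Real.Gamma_pos_of_pos (show 0 < 1 - l by linarith)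
  simp only [Nat.cast_zero, zero_add]
  field_simp

lemma mlC_succ (l : ℝ) (hl : l < 1) (a b : ℕ) :
    mlC l (a + 1) b * (a + 1 + b - l) = mlC l a b * (a + 1 - l) := by
  unfold mlC
  have ha : (0 : ℝ) ≤ a := a.cast_nonneg
  have hb : (0 : ℝ) ≤ b := b.cast_nonneg
  have p1 : 0 < (a : ℝ) + 1 - l := by linarith
  have p3 : 0 < (a : ℝ) + b + 1 - l := by linarith
  have h3 := Real.Gamma_pos_of_pos p3
  have h4 := Real.Gamma_pos_of_pos (show 0 < 1 - l by linarith)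
  have e1 := Real.Gamma_add_one p1.ne'
  have e3 := Real.Gamma_add_one p3.ne'
  have q1 : ((a + 1 : ℕ) : ℝ) + 1 - l = a + 1 - l + 1 := by push_cast; ring
  have q3 : ((a + 1 : ℕ) : ℝ) + b + 1 - l = a + b + 1 - l + 1 := by push_cast; ring
  rw [q1, q3, e1, e3, show (a : ℝ) + 1 + b - l = a + b + 1 - l by ring]
  field_simp

lemma mlC_diff (l : ℝ) (hl : l < 1) (a b : ℕ) :
    mlC l a b - mlC l (a + 1) b = mlC l (a + 1) b * b / (a + 1 - l) := by
  have ha : (0 : ℝ) ≤ a := a.cast_nonneg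
  have p1 : 0 < (a : ℝ) + 1 - l := by linarith
  rw [eq_div_iff p1.ne']
  linear_combination - mlC_succ l hl a b

lemma mlC_le (l : ℝ) (hl : l < 1) (a b : ℕ) : mlC l a (b + 1) ≤ (1 - l) / (a + 1 - l) := by
  have ha : (0 : ℝ) ≤ a := a.cast_nonneg
  have p1 : 0 < (a : ℝ) + 1 - l := by linarith
  induction b with
  | zero =>
    rw [le_div_iff₀ p1, mlC_symm]
    have := mlC_succ l hl 0 a
    rw [mlC_zero l hl] at this
    push_cast at this
    apply le_of_eq
    linear_combination this
  | succ b ih =>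
    refine le_trans ?_ ih
    have := mlC_diff l hl (b + 1) a
    rw [mlC_symm l a, mlC_symm l a]
    have hb : (0 : ℝ) ≤ (b + 1 : ℕ) := (b + 1).cast_nonneg
    have p2 : 0 < ((b + 1 : ℕ) : ℝ) + 1 - l := by linarith
    have := mlC_pos l hl (b + 1 + 1) a
    have : 0 ≤ mlC l (b + 1 + 1) a * a / ((b + 1 : ℕ) + 1 - l) := by positivity
    linarith

lemma mlC_tendsto (l : ℝ) (hl : l < 1) (b : ℕ) :
    Filter.Tendsto (fun a => mlC l a (b + 1)) Filter.atTop (nhds 0) := by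
  refine squeeze_zero (fun a => (mlC_pos l hl a _).le) (fun a => mlC_le l hl a b) ?_
  apply Filter.Tendsto.const_div_atTop
  have := Filter.tendsto_atTop_add_const_right Filter.atTop (1 - l)
    (tendsto_natCast_atTop_atTop (R := ℝ))
  simpa [add_sub_assoc] using this

lemma mlC_key (l : ℝ) (hl : l < 1) (n m : ℕ) (x : ℝ) (hx : 0 ≤ x) :
    ∑' k : ℕ, ENNReal.ofReal (x * (mlC l (n + k + 1) (m + 1) / ((n : ℝ) + k + 1 - l)))
      = ENNReal.ofReal (x * (mlC l n (m + 1) / (m + 1))) := by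
  have hn : (0 : ℝ) ≤ n := n.cast_nonneg
  have hm : (0 : ℝ) < (m : ℝ) + 1 := by positivity
  have hnon : ∀ k : ℕ, 0 ≤ x * (mlC l (n + k + 1) (m + 1) / ((n : ℝ) + k + 1 - l)) := by
    intro k
    have hk : (0 : ℝ) ≤ k := k.cast_nonneg
    have p : 0 < (n : ℝ) + k + 1 - l := by linarith
    have := mlC_pos l hl (n + k + 1) (m + 1)
    positivity
  have hs : HasSum (fun k : ℕ => x * (mlC l (n + k + 1) (m + 1) / ((n : ℝ) + k + 1 - l)))
      (x * (mlC l n (m + 1) / (m + 1))) := by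
    rw [hasSum_iff_tendsto_nat_of_nonneg hnon]
    have hsum : ∀ N : ℕ, ∑ k ∈ Finset.range N,
        x * (mlC l (n + k + 1) (m + 1) / ((n : ℝ) + k + 1 - l))
        = x * ((mlC l n (m + 1) - mlC l (N + n) (m + 1)) / (m + 1)) := by
      intro N
      induction N with
      | zero => simp
      | succ N ih =>
        rw [Finset.sum_range_succ, ih]
        have hk : (0 : ℝ) ≤ N := N.cast_nonneg
        have p : 0 < (n : ℝ) + N + 1 - l := by linarith
        have d := mlC_diff l hl (n + N) (m + 1)
        rw [show N + 1 + n = n + N + 1 by ring, show N + n = n + N by ring]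
        push_cast at d
        have : mlC l (n + N + 1) (m + 1) / ((n : ℝ) + N + 1 - l)
          = (mlC l (n + N) (m + 1) - mlC l (n + N + 1) (m + 1)) / (m + 1) := by
          rw [d]; field_simp
        rw [this]; ring
    simp only [hsum]
    have t := (Filter.tendsto_add_atTop_iff_nat n).2 (mlC_tendsto l hl m)
    have := ((t.const_sub (mlC l n (m + 1))).div_const ((m : ℝ) + 1)).const_mul x
    simpa using this
  rw [← ENNReal.ofReal_tsum_of_nonneg hnon hs.summable, hs.tsum_eq]

def mlE : ℕ × ℕ ≃ {p : ℕ × ℕ // 0 < p.2 ∧ p.2 < p.1} where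
  toFun q := ⟨(q.1 + q.2 + 2, q.1 + 1), by constructor <;> simp⟩
  invFun p := (p.1.2 - 1, p.1.1 - p.1.2 - 1)
  left_inv q := by
    ext <;> simp
    omega
  right_inv p := by
    obtain ⟨⟨a, b⟩, h1, h2⟩ := p
    simp only at h1 h2
    ext <;> simp <;> omega

lemma mlEN (l : ℝ) (hl : l < 1) :
    ∑' n : ℕ, ENNReal.ofReal (1 / (((n : ℝ) + 1) ^ 2 * (((n : ℝ) + 1) - l)))
      = ∑' c : ℕ, ∑' k : ℕ, ENNReal.ofReal
        (1 / (((c : ℝ) + k + 2) * ((c : ℝ) + k + 2 - l) * ((c : ℝ) + 1 - l))) := by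
  have P : ∀ a : ℕ, 0 < (a : ℝ) + 1 - l := fun a => by
    have : (0 : ℝ) ≤ a := a.cast_nonneg
    linarith
  have P2 : ∀ c k : ℕ, 0 < (c : ℝ) + k + 2 - l := fun c k => by
    have : (0 : ℝ) ≤ c := c.cast_nonneg
    have : (0 : ℝ) ≤ k := k.cast_nonneg
    linarith
  symm
  calc _ = ∑' c : ℕ, ∑' k : ℕ, ∑' a : ℕ, ENNReal.ofReal
        (1 / (((c : ℝ) + k + 2 - l) * ((c : ℝ) + 1 - l) * (a + 1 - l)) *
          mlC l (a + 1) (c + k + 2)) := by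
        refine tsum_congr fun c => tsum_congr fun k => ?_
        have p1 := P c
        have p2 := P2 c k
        have := mlC_key l hl 0 (c + k + 1) (1 / (((c : ℝ) + k + 2 - l) * ((c : ℝ) + 1 - l)))
          (by positivity)
        rw [mlC_zero l hl] at this
        push_cast at this
        refine Eq.trans ?_ (this.symm.trans ?_)
        · congr 1
          rw [show (c : ℝ) + k + 1 + 1 = c + k + 2 by ring]
          field_simp
        · refine tsum_congr fun a => ?_
          have p3 := P a
          congr 1
          simp only [zero_add]
          rw [show c + k + 1 + 1 = c + k + 2 by ring]
          field_simp
    _ = ∑' c : ℕ, ∑' a : ℕ, ∑' k : ℕ, ENNReal.ofReal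
        (1 / (((c : ℝ) + k + 2 - l) * ((c : ℝ) + 1 - l) * (a + 1 - l)) *
          mlC l (a + 1) (c + k + 2)) := tsum_congr fun c => ENNReal.tsum_comm
    _ = ∑' c : ℕ, ∑' a : ℕ, ENNReal.ofReal
        (1 / (((c : ℝ) + 1 - l) * (a + 1 - l) * (a + 1)) * mlC l (a + 1) (c + 1)) := by
        refine tsum_congr fun c => tsum_congr fun a => ?_
        have p1 := P c
        have p3 := P a
        have := mlC_key l hl (c + 1) a (1 / (((c : ℝ) + 1 - l) * (a + 1 - l)))
          (by positivity)
        push_cast at this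
        refine Eq.trans ?_ (this.trans ?_)
        · refine tsum_congr fun k => ?_
          have p2 := P2 c k
          congr 1
          rw [mlC_symm, show c + 1 + k + 1 = c + k + 2 by ring,
            show (c : ℝ) + 1 + k + 1 - l = c + k + 2 - l by ring]
          field_simp
        · congr 1
          rw [mlC_symm]
          field_simp
    _ = ∑' a : ℕ, ∑' c : ℕ, ENNReal.ofReal
        (1 / (((c : ℝ) + 1 - l) * (a + 1 - l) * (a + 1)) * mlC l (a + 1) (c + 1)) :=
        ENNReal.tsum_comm
    _ = _ := by
        refine tsum_congr fun a => ?_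
        have p3 := P a
        have := mlC_key l hl 0 a (1 / (((a : ℝ) + 1 - l) * (a + 1))) (by positivity)
        rw [mlC_zero l hl] at this
        push_cast at this
        refine Eq.trans ?_ (this.trans ?_)
        · refine tsum_congr fun c => ?_
          have p1 := P c
          congr 1
          simp only [zero_add]
          rw [mlC_symm]
          field_simp
        · congr 1
          field_simp

/-- For every real `λ < 1`,
`∑_{n ≥ 1} 1/(n² (n-λ)) = ∑_{n₁ > n₂ > 0} 1/(n₁ (n₁-λ)(n₂-λ))`. -/
theorem mellin_landen_depth_two (lam : ℝ) (hlam : lam < 1) :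
    ∑' n : ℕ, 1 / (((n : ℝ) + 1) ^ 2 * (((n : ℝ) + 1) - lam))
      = ∑' p : {p : ℕ × ℕ // 0 < p.2 ∧ p.2 < p.1},
          1 / ((p.1.1 : ℝ) * ((p.1.1 : ℝ) - lam) * ((p.1.2 : ℝ) - lam)) := by
  have P : ∀ a : ℕ, 0 < (a : ℝ) + 1 - lam := fun a => by
    have : (0 : ℝ) ≤ a := a.cast_nonneg
    linarith
  have P2 : ∀ c k : ℕ, 0 < (c : ℝ) + k + 2 - lam := fun c k => by
    have : (0 : ℝ) ≤ c := c.cast_nonneg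
    have : (0 : ℝ) ≤ k := k.cast_nonneg
    linarith
  rw [← mlE.tsum_eq]
  have h := mlEN lam hlam
  rw [← ENNReal.tsum_prod (f := fun c k : ℕ => ENNReal.ofReal
        (1 / (((c : ℝ) + k + 2) * ((c : ℝ) + k + 2 - lam) * ((c : ℝ) + 1 - lam))))] at h
  have h2 := congrArg ENNReal.toReal h
  rw [ENNReal.tsum_toReal_eq (fun _ => ENNReal.ofReal_ne_top),
    ENNReal.tsum_toReal_eq (fun _ => ENNReal.ofReal_ne_top)] at h2
  refine Eq.trans ?_ (h2.trans ?_)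
  · refine tsum_congr fun a => ?_
    have := P a
    rw [ENNReal.toReal_ofReal (by positivity)]
  · refine tsum_congr fun q => ?_
    have := P q.1
    have := P2 q.1 q.2
    rw [ENNReal.toReal_ofReal (by positivity)]
    simp [mlE]
end
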